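/- Write T_k = k(k+1)/2. For m ≥ 1 and n = T_m, let p(m) denote the probability that a uniformly random partition λ of n admits a decomposition λ = λ1 +_H λ2 +_H λ3 +_H λ4, where λ1 ⊢ T_{⌊(m+1)/2⌋} is dominance-comparable to ρ_{⌊(m+1)/2⌋}, λ2 ⊢ T_{⌊m/2⌋} and λ3 ⊢ T_{⌊m/2⌋} are each dominance-comparable to ρ_{⌊m/2⌋}, and λ4 ⊢ T_{⌊(m−1)/2⌋} is dominance-comparable to ρ_{⌊(m−1)/2⌋}. Then p(m) → 1 as m → ∞. -/

import Mathlib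

/-- A partition, encoded by its weakly decreasing (0-indexed) sequence of parts,
eventually zero.  Horizontal sum `+_H` is pointwise addition of part functions. -/
def IsPtnFun (f : ℕ → ℕ) : Prop :=
  Antitone f ∧ ∃ N, ∀ i, N ≤ i → f i = 0

/-- The size (number of boxes) of a partition: the sum of its parts. -/
noncomputable def psize (f : ℕ → ℕ) : ℕ := ∑' i, f i

/-- The staircase partition `ρ_m = (m, m-1, …, 1)`. -/
def rho (m : ℕ) : ℕ → ℕ := fun i => m - i

/-- The triangular number `T_k = k(k+1)/2`. -/
def tri (k : ℕ) : ℕ := k * (k + 1) / 2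

/-- `f` dominates `g`: every partial sum of parts of `f` is at least that of `g`. -/
def Dominates (f g : ℕ → ℕ) : Prop :=
  ∀ r : ℕ, ∑ i ∈ Finset.range r, g i ≤ ∑ i ∈ Finset.range r, f i

/-- Dominance-comparability. -/
def DomComparable (f g : ℕ → ℕ) : Prop := Dominates f g ∨ Dominates g f

/-- `λ ⊢ T_m` admits a decomposition `λ = λ₁ +_H λ₂ +_H λ₃ +_H λ₄` where
`λ₁ ⊢ T_{⌊(m+1)/2⌋}`, `λ₂, λ₃ ⊢ T_{⌊m/2⌋}`, `λ₄ ⊢ T_{⌊(m-1)/2⌋}`, each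
dominance-comparable to the staircase of the corresponding size. -/
def GoodDecomp (m : ℕ) (f : ℕ → ℕ) : Prop :=
  ∃ g₁ g₂ g₃ g₄ : ℕ → ℕ,
    IsPtnFun g₁ ∧ IsPtnFun g₂ ∧ IsPtnFun g₃ ∧ IsPtnFun g₄ ∧
    psize g₁ = tri ((m + 1) / 2) ∧ psize g₂ = tri (m / 2) ∧
    psize g₃ = tri (m / 2) ∧ psize g₄ = tri ((m - 1) / 2) ∧
    DomComparable g₁ (rho ((m + 1) / 2)) ∧ DomComparable g₂ (rho (m / 2)) ∧
    DomComparable g₃ (rho (m / 2)) ∧ DomComparable g₄ (rho ((m - 1) / 2)) ∧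
    f = g₁ + g₂ + g₃ + g₄

/-- The conjugate of the multiset of parts `M`, as a part function. -/
def conjFun (M : Multiset ℕ) : ℕ → ℕ := fun r => M.countP (r < ·)

theorem conjFun_add (M N : Multiset ℕ) : conjFun (M + N) = conjFun M + conjFun N := by
  funext r; simp [conjFun]

theorem conjFun_eq_zero {M : Multiset ℕ} {r : ℕ} (h : M.sum ≤ r) : conjFun M r = 0 := by
  unfold conjFun
  rw [Multiset.countP_eq_zero]
  intro a ha
  have := Multiset.single_le_sum (fun x _ => Nat.zero_le x) a ha
  omega

theorem isPtnFun_conjFun (M : Multiset ℕ) : IsPtnFun (conjFun M) := by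
  refine ⟨?_, M.sum, fun i hi => conjFun_eq_zero hi⟩
  intro r r' h
  unfold conjFun
  rw [Multiset.countP_eq_card_filter, Multiset.countP_eq_card_filter]
  apply Multiset.card_le_card
  apply Multiset.monotone_filter_right
  intro a ha
  omega

theorem sum_range_conjFun (M : Multiset ℕ) (R : ℕ) :
    ∑ i ∈ Finset.range R, conjFun M i = (M.map (fun a => min a R)).sum := by
  unfold conjFun
  induction M using Multiset.induction_on with
  | empty => simp
  | cons a M ih =>
    simp only [Multiset.countP_cons, Finset.sum_add_distrib, ih, Multiset.map_cons,
      Multiset.sum_cons]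
    rw [add_comm]
    congr 1
    rw [Finset.sum_ite]
    simp only [Finset.sum_const, smul_eq_mul, mul_one, mul_zero, add_zero]
    have : Finset.filter (fun x => x < a) (Finset.range R) = Finset.range (min a R) := by
      ext x; simp; omega
    rw [this, Finset.card_range]

theorem sum_map_min_le (M : Multiset ℕ) (R : ℕ) : (M.map (fun a => min a R)).sum ≤ M.sum := by
  conv_rhs => rw [← Multiset.map_id M]
  exact Multiset.sum_map_le_sum_map _ _ (fun a _ => min_le_left _ _)

theorem psize_conjFun (M : Multiset ℕ) : psize (conjFun M) = M.sum := by
  unfold psize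
  rw [tsum_eq_sum (s := Finset.range M.sum)
    (fun b hb => conjFun_eq_zero (by simpa using hb)), sum_range_conjFun]
  conv_rhs => rw [← Multiset.map_id M]
  congr 1
  apply Multiset.map_congr rfl
  intro a ha
  exact min_eq_left (Multiset.single_le_sum (fun x _ => Nat.zero_le x) a ha)

theorem two_mul_tri (k : ℕ) : 2 * tri k = k * k + k := by
  unfold tri
  rw [Nat.mul_div_cancel' (Nat.even_mul_succ_self k).two_dvd]; ring

theorem sum_range_rho {k R : ℕ} (h : R ≤ k) :
    2 * ∑ i ∈ Finset.range R, rho k i + R * R = 2 * R * k + R := by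
  unfold rho
  induction R with
  | zero => simp
  | succ R ih =>
    have := ih (by omega)
    rw [Finset.sum_range_succ]
    obtain ⟨d, rfl⟩ := Nat.exists_eq_add_of_le h
    have e : R + 1 + d - R = 1 + d := by omega
    rw [e]
    nlinarith

theorem sum_range_rho_of_ge {k R : ℕ} (h : k ≤ R) :
    ∑ i ∈ Finset.range R, rho k i = tri k := by
  have h1 : ∑ i ∈ Finset.range R, rho k i = ∑ i ∈ Finset.range k, rho k i := by
    symm
    apply Finset.sum_subset (by simpa using h)
    intro x _ hx
    simp [rho] at *; omega
  have h2 := sum_range_rho (le_refl k)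
  have h3 := two_mul_tri k
  rw [h1]; nlinarith

theorem rho_dominates_conjFun {M : Multiset ℕ} {k : ℕ} (hs : M.sum = tri k)
    (h : ∀ R ≤ k, 2 * (M.map (fun a => min a R)).sum + R * R ≤ 2 * R * k + R) :
    Dominates (rho k) (conjFun M) := by
  intro R
  rw [sum_range_conjFun]
  rcases le_total R k with hR | hR
  · have := h R hR
    have := sum_range_rho hR
    omega
  · rw [sum_range_rho_of_ge hR, ← hs]
    exact sum_map_min_le _ _

theorem conjFun_dominates_rho {M : Multiset ℕ} {k : ℕ}
    (h : ∀ R ≤ k, 2 * R * k + R ≤ 2 * (M.map (fun a => min a R)).sum + R * R) :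
    Dominates (conjFun M) (rho k) := by
  intro R
  rcases le_total R k with hR | hR
  · have := h R hR
    have := sum_range_rho hR
    rw [sum_range_conjFun]
    omega
  · rw [sum_range_rho_of_ge hR]
    have h1 := h k le_rfl
    have h2 := two_mul_tri k
    have h3 : ∑ i ∈ Finset.range k, conjFun M i ≤ ∑ i ∈ Finset.range R, conjFun M i :=
      Finset.sum_le_sum_of_subset (by simpa using hR)
    rw [← sum_range_conjFun] at h1
    nlinarith

/-- Few parts, with enough mass in parts of size at least `k`: the staircase dominates the
conjugate. -/
theorem rho_dominates_of_card_le {A N : Multiset ℕ} {k : ℕ} (hs : (A + N).sum = tri k)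
    (hA : ∀ a ∈ A, k ≤ a) (hAs : 56 * (k * k) + 100 * k ≤ 200 * A.sum)
    (hc : 100 * (A + N).card ≤ 78 * k) : Dominates (rho k) (conjFun (A + N)) := by
  apply rho_dominates_conjFun hs
  intro R hR
  have hT := two_mul_tri k
  by_cases hRk : 100 * R ≤ 44 * k
  · have h1 : ((A + N).map (fun a => min a R)).sum ≤ (A + N).card * R := by
      have := Multiset.sum_le_card_nsmul ((A + N).map (fun a => min a R)) R (by
        intro x hx
        obtain ⟨a, _, rfl⟩ := Multiset.mem_map.1 hx
        exact min_le_right _ _)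
      simpa using this
    have h2 : 2 * (A + N).card + R ≤ 2 * k := by omega
    nlinarith [Nat.mul_le_mul_right R h2]
  · have h1 : ∀ B : Multiset ℕ, (∀ a ∈ B, k ≤ a) →
        k * (B.map (fun a => min a R)).sum + B.sum * (k - R) ≤ k * B.sum := by
      intro B
      induction B using Multiset.induction_on with
      | empty => simp
      | cons a B ih =>
        intro hB
        have ih' := ih (fun x hx => hB x (Multiset.mem_cons_of_mem hx))
        have ha := hB a (Multiset.mem_cons_self _ _)
        simp only [Multiset.map_cons, Multiset.sum_cons]
        rw [min_eq_right (hR.trans ha)]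
        obtain ⟨d, rfl⟩ := Nat.exists_eq_add_of_le hR
        obtain ⟨e, rfl⟩ := Nat.exists_eq_add_of_le ha
        rw [Nat.add_sub_cancel_left] at ih' ⊢
        nlinarith
    have hA1 := h1 A hA
    have hN := Nat.mul_le_mul_left k (sum_map_min_le N R)
    rw [Multiset.map_add, Multiset.sum_add]
    rw [Multiset.sum_add] at hs
    obtain ⟨d, rfl⟩ := Nat.exists_eq_add_of_le hR
    rw [Nat.add_sub_cancel_left] at hA1
    push Not at hRk
    have hk : 0 < R + d := by omega
    have h3 : (R + d) * (d + 1) ≤ 2 * A.sum := by nlinarith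
    have h4 := Nat.mul_le_mul_right d h3
    refine Nat.le_of_mul_le_mul_left ?_ hk
    nlinarith

/-- Only small parts: the conjugate dominates the staircase. -/
theorem dominates_rho_of_small {S X : Multiset ℕ} {k : ℕ} (hk : 100 ≤ k)
    (hs : (S + X).sum = tri k)
    (hS : ∀ a ∈ S, 100 * a ≤ 45 * k) (hX : ∀ a ∈ X, 100 * a ≤ 71 * k)
    (hXs : 100 * X.sum ≤ 11 * (k * k)) : Dominates (conjFun (S + X)) (rho k) := by
  apply conjFun_dominates_rho
  intro R hR
  have hT := two_mul_tri k
  rw [Multiset.map_add, Multiset.sum_add]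
  rw [Multiset.sum_add] at hs
  have key : ∀ (c : ℕ) (B : Multiset ℕ), (∀ a ∈ B, 100 * a ≤ c * k) → 100 * R ≤ c * k →
      100 * (R * B.sum) ≤ c * k * (B.map (fun a => min a R)).sum := by
    intro c B
    induction B using Multiset.induction_on with
    | empty => simp
    | cons a B ih =>
      intro hB hc
      have ih' := ih (fun x hx => hB x (Multiset.mem_cons_of_mem hx)) hc
      have ha := hB a (Multiset.mem_cons_self _ _)
      simp only [Multiset.map_cons, Multiset.sum_cons]
      rcases le_total a R with h | h
      · rw [min_eq_left h]; nlinarith [Nat.mul_le_mul_right a hc]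
      · rw [min_eq_right h]; nlinarith [Nat.mul_le_mul_right R ha]
  have full : ∀ (B : Multiset ℕ), (∀ a ∈ B, a ≤ R) → (B.map (fun a => min a R)).sum = B.sum := by
    intro B hB
    conv_rhs => rw [← Multiset.map_id B]
    congr 1
    exact Multiset.map_congr rfl (fun a ha => min_eq_left (hB a ha))
  by_cases h1 : 100 * R ≤ 45 * k
  · have kS := key 45 S hS h1
    have kX := key 71 X hX (by omega)
    set σ := (S.map (fun a => min a R)).sum
    set τ := (X.map (fun a => min a R)).sum
    rcases Nat.eq_zero_or_pos R with h0 | h0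
    · subst h0; simp
    have hk0 : 0 < k := by omega
    refine Nat.le_of_mul_le_mul_left ?_ (Nat.mul_pos (by norm_num : 0 < 3195) hk0)
    have e1 := Nat.mul_le_mul_left R hXs
    have e2 : R * S.sum + R * X.sum = R * tri k := by rw [← hs]; ring
    have e3 : 2 * (R * tri k) = R * (k * k) + R * k := by rw [← mul_add, ← hT]; ring
    have e4 : 1 * k ≤ R * k := Nat.mul_le_mul_right k h0
    nlinarith [Nat.mul_le_mul_left (R * k) hk, Nat.zero_le (R * R * k)]
  · rw [full S (fun a ha => by have := hS a ha; omega)]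
    by_cases h2 : 71 * k ≤ 100 * R
    · rw [full X (fun a ha => by have := hX a ha; omega), hs]
      obtain ⟨d, rfl⟩ := Nat.exists_eq_add_of_le hR
      nlinarith
    · have kX : 45 * X.sum ≤ 71 * (X.map (fun a => min a R)).sum := by
        clear hs hXs
        induction X using Multiset.induction_on with
        | empty => simp
        | cons a B ih =>
          have ih' := ih (fun x hx => hX x (Multiset.mem_cons_of_mem hx))
          have ha := hX a (Multiset.mem_cons_self _ _)
          simp only [Multiset.map_cons, Multiset.sum_cons]
          rcases le_total a R with h | h
          · rw [min_eq_left h]; omega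
          · rw [min_eq_right h]; omega
      obtain ⟨d, rfl⟩ := Nat.exists_eq_add_of_le hR
      have hd : 29 * (R + d) ≤ 100 * d := by omega
      have hd2 := Nat.mul_le_mul hd hd
      nlinarith

/-- Greedy selection of a submultiset with sum just below a target. -/
theorem exists_le_sum_near (M : Multiset ℕ) (b t : ℕ) (hb : ∀ a ∈ M, a ≤ b) (ht : t ≤ M.sum) :
    ∃ U V, M = U + V ∧ U.sum ≤ t ∧ t ≤ U.sum + b := by
  induction M using Multiset.induction_on with
  | empty => exact ⟨0, 0, by simp, by simp, by simp at ht; simp [ht]⟩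
  | cons a M ih =>
    by_cases h : t ≤ M.sum
    · obtain ⟨U, V, h1, h2, h3⟩ := ih (fun x hx => hb x (Multiset.mem_cons_of_mem hx)) h
      exact ⟨U, a ::ₘ V, by rw [h1, Multiset.add_cons], h2, h3⟩
    · refine ⟨M, {a}, by rw [add_comm, Multiset.singleton_add], by omega, ?_⟩
      have := hb a (Multiset.mem_cons_self _ _)
      simp only [Multiset.sum_cons] at ht
      omega

/-- Choosing one element from each pair `(a, a + 1)`. -/
theorem exists_flip (J : Finset ℕ) (g : ℕ) (hg : g ≤ J.card) :
    ∃ U V : Multiset ℕ, J.val + J.val.map (· + 1) = U + V ∧ U.sum = J.val.sum + g := by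
  obtain ⟨I, hI, rfl⟩ := Finset.exists_subset_card_eq hg
  obtain ⟨W, hW⟩ := exists_add_of_le (Finset.val_le_iff.2 hI)
  refine ⟨I.val.map (· + 1) + W, I.val + W.map (· + 1), ?_, ?_⟩
  · rw [hW, Multiset.map_add]; abel
  · rw [hW, Multiset.sum_add, Multiset.sum_add, Multiset.sum_map_add]; simp; ring

theorem filter_split (P : Multiset ℕ) (p q : ℕ → Prop) [DecidablePred p] [DecidablePred q]
    (h : ∀ a, p a → q a) : P.filter q = P.filter p + P.filter (fun a => ¬ p a ∧ q a) := by
  rw [← Multiset.filter_add_not p (P.filter q), Multiset.filter_filter, Multiset.filter_filter]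
  congr 1
  exact Multiset.filter_congr (fun a _ => ⟨fun h => h.1, fun hp => ⟨hp, h a hp⟩⟩)

/-- A multiset missing few sizes contains many consecutive pairs of sizes up to `K` and,
disjointly from them, a set of sizes up to `D` of large total mass. -/
theorem exists_reserve (P : Multiset ℕ) (D K : ℕ) (hD : 1 ≤ D) (hDK : 100 * D ≤ K)
    (hK : 4 * ((Finset.Icc 1 K).filter (· ∉ P)).card ≤ K)
    (hD' : 4 * ((Finset.Icc 1 D).filter (· ∉ P)).card ≤ D) :
    ∃ F J₁ J₂ J₃ : Finset ℕ,
      F.val + ((J₁.val + J₁.val.map (· + 1)) + (J₂.val + J₂.val.map (· + 1)) +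
        (J₃.val + J₃.val.map (· + 1))) ≤ P ∧
      J₁.card = D ∧ J₂.card = D ∧ J₃.card = D ∧ F.card ≤ D ∧ (∀ a ∈ F, a ≤ D) ∧
      (∀ a ∈ J₁, a + 1 ≤ K) ∧ (∀ a ∈ J₂, a + 1 ≤ K) ∧ (∀ a ∈ J₃, a + 1 ≤ K) ∧
      D * D ≤ 4 * F.val.sum := by
  classical
  set F := (Finset.Icc 1 D).filter (· ∈ P) with hF
  set Q := (Finset.Ico D (K / 2)).filter (fun i => 2 * i ∈ P ∧ 2 * i + 1 ∈ P) with hQ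
  have hQc : 3 * D ≤ Q.card := by
    have h1 := Finset.card_filter_add_card_filter_not (s := Finset.Ico D (K / 2))
      (fun i => 2 * i ∈ P ∧ 2 * i + 1 ∈ P)
    have h2 : ((Finset.Ico D (K / 2)).filter
        (fun i => ¬ (2 * i ∈ P ∧ 2 * i + 1 ∈ P))).card ≤
        ((Finset.Icc 1 K).filter (· ∉ P)).card := by
      apply Finset.card_le_card_of_injOn (fun i => if 2 * i ∈ P then 2 * i + 1 else 2 * i)
      · intro i hi
        simp only [Finset.coe_filter, Finset.mem_Ico, Set.mem_ofPred_eq] at hi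
        simp only [Finset.coe_filter, Finset.mem_Icc, Set.mem_ofPred_eq]
        split_ifs with h
        · exact ⟨by omega, fun h' => hi.2 ⟨h, h'⟩⟩
        · exact ⟨by omega, h⟩
      · intro i _ j _ hij
        simp only at hij
        split_ifs at hij <;> omega
    rw [Nat.card_Ico] at h1
    rw [← hQ] at h1
    omega
  obtain ⟨Q₁, hQ₁, c₁⟩ := Finset.exists_subset_card_eq (show D ≤ Q.card by omega)
  have hc1 : (Q \ Q₁).card = Q.card - D := by rw [Finset.card_sdiff_of_subset hQ₁, c₁]
  obtain ⟨Q₂, hQ₂, c₂⟩ := Finset.exists_subset_card_eq (show D ≤ (Q \ Q₁).card by omega)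
  have hc2 : ((Q \ Q₁) \ Q₂).card = Q.card - D - D := by
    rw [Finset.card_sdiff_of_subset hQ₂, c₂, hc1]
  obtain ⟨Q₃, hQ₃, c₃⟩ := Finset.exists_subset_card_eq (show D ≤ ((Q \ Q₁) \ Q₂).card by omega)
  have m2 : ∀ i ∈ Q₂, i ∈ Q ∧ i ∉ Q₁ := fun i hi => by simpa using hQ₂ hi
  have m3 : ∀ i ∈ Q₃, (i ∈ Q ∧ i ∉ Q₁) ∧ i ∉ Q₂ := fun i hi => by simpa using hQ₃ hi
  have hm : ∀ i ∈ Q, (D ≤ i ∧ i < K / 2) ∧ 2 * i ∈ P ∧ 2 * i + 1 ∈ P := fun i hi => by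
    simpa [hQ] using hi
  set e : ℕ ↪ ℕ := ⟨fun i => 2 * i, fun i j h => by simpa using h⟩ with he
  have ee : ∀ i, e i = 2 * i := fun i => rfl
  refine ⟨F, Q₁.map e, Q₂.map e, Q₃.map e, ?_, by simpa, by simpa, by simpa, ?_, ?_, ?_, ?_, ?_, ?_⟩
  · rw [Multiset.le_iff_subset]
    · intro a ha
      simp only [Multiset.mem_add, Finset.mem_val, Multiset.mem_map, Finset.mem_map, ee] at ha
      rcases ha with h | ((⟨i, hi, rfl⟩ | ⟨_, ⟨i, hi, rfl⟩, rfl⟩) |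
        (⟨i, hi, rfl⟩ | ⟨_, ⟨i, hi, rfl⟩, rfl⟩)) | (⟨i, hi, rfl⟩ | ⟨_, ⟨i, hi, rfl⟩, rfl⟩)
      · simp [hF] at h; exact h.2
      · exact (hm i (hQ₁ hi)).2.1
      · exact (hm i (hQ₁ hi)).2.2
      · exact (hm i (m2 i hi).1).2.1
      · exact (hm i (m2 i hi).1).2.2
      · exact (hm i (m3 i hi).1.1).2.1
      · exact (hm i (m3 i hi).1.1).2.2
    · have nd : ∀ I : Finset ℕ, ((I.map e).val + (I.map e).val.map (· + 1)).Nodup := by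
        intro I
        rw [Multiset.nodup_add]
        refine ⟨(I.map e).nodup, ((I.map e).nodup).map (fun a b h => by simpa using h), ?_⟩
        rw [Multiset.disjoint_left]
        intro a ha hb
        simp only [Finset.mem_val, Multiset.mem_map, Finset.mem_map, ee] at ha hb
        obtain ⟨i, _, rfl⟩ := ha
        obtain ⟨_, ⟨j, _, rfl⟩, h⟩ := hb
        omega
      have dj : ∀ I I' : Finset ℕ, (∀ i ∈ I', i ∉ I) →
          Disjoint ((I.map e).val + (I.map e).val.map (· + 1))
            ((I'.map e).val + (I'.map e).val.map (· + 1)) := by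
        intro I I' h
        rw [Multiset.disjoint_left]
        intro a ha hb
        simp only [Multiset.mem_add, Finset.mem_val, Multiset.mem_map, Finset.mem_map, ee] at ha hb
        rcases ha with ⟨i, hi, rfl⟩ | ⟨_, ⟨i, hi, rfl⟩, rfl⟩ <;>
        rcases hb with ⟨j, hj, hh⟩ | ⟨_, ⟨j, hj, rfl⟩, hh⟩ <;>
        first
          | omega
          | (obtain rfl : i = j := by omega
             exact h _ hj hi)
      rw [Multiset.nodup_add, Multiset.nodup_add, Multiset.nodup_add]
      refine ⟨F.nodup, ⟨⟨nd _, nd _, dj _ _ (fun i hi => (m2 i hi).2)⟩, nd _,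
        Multiset.disjoint_add_left.2 ⟨dj _ _ (fun i hi => (m3 i hi).1.2),
          dj _ _ (fun i hi => (m3 i hi).2)⟩⟩, ?_⟩
      rw [Multiset.disjoint_left]
      intro a ha hb
      simp only [Multiset.mem_add, Finset.mem_val, Multiset.mem_map, Finset.mem_map, ee] at ha hb
      simp [hF] at ha
      rcases hb with ((⟨i, hi, rfl⟩ | ⟨_, ⟨i, hi, rfl⟩, rfl⟩) |
        (⟨i, hi, rfl⟩ | ⟨_, ⟨i, hi, rfl⟩, rfl⟩)) | (⟨i, hi, rfl⟩ | ⟨_, ⟨i, hi, rfl⟩, rfl⟩)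
      · have := (hm i (hQ₁ hi)).1; omega
      · have := (hm i (hQ₁ hi)).1; omega
      · have := (hm i (m2 i hi).1).1; omega
      · have := (hm i (m2 i hi).1).1; omega
      · have := (hm i (m3 i hi).1.1).1; omega
      · have := (hm i (m3 i hi).1.1).1; omega
  · calc F.card ≤ (Finset.Icc 1 D).card := Finset.card_filter_le _ _
      _ = D := by simp
  · intro a ha; simp [hF] at ha; exact ha.1.2
  · intro a ha
    obtain ⟨i, hi, rfl⟩ := Finset.mem_map.1 ha
    have := (hm i (hQ₁ hi)).1; rw [ee]; omega
  · intro a ha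
    obtain ⟨i, hi, rfl⟩ := Finset.mem_map.1 ha
    have := (hm i (m2 i hi).1).1; rw [ee]; omega
  · intro a ha
    obtain ⟨i, hi, rfl⟩ := Finset.mem_map.1 ha
    have := (hm i (m3 i hi).1.1).1; rw [ee]; omega
  · have h1 := Finset.sum_filter_add_sum_filter_not (Finset.Icc 1 D) (· ∈ P) (fun i => i)
    have h2 : ∑ i ∈ (Finset.Icc 1 D).filter (· ∉ P), i ≤
        ((Finset.Icc 1 D).filter (· ∉ P)).card * D := by
      apply Finset.sum_le_card_nsmul
      intro x hx; simp at hx; exact hx.1.2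
    have h3 : 2 * ∑ i ∈ Finset.Icc 1 D, i = D * D + D := by
      have h := Finset.sum_range_id_mul_two (D + 1)
      have h' : ∑ i ∈ Finset.range (D + 1), i = ∑ i ∈ Finset.Icc 1 D, i := by
        rw [Finset.range_eq_Ico, Finset.sum_eq_sum_Ico_succ_bot (by omega)]
        simp; rfl
      rw [← h', mul_comm, h]; simp; ring
    have h4 : F.val.sum = ∑ i ∈ (Finset.Icc 1 D).filter (· ∈ P), i := by
      rw [← hF, Finset.sum_eq_multiset_sum]; simp
    rw [h4]
    nlinarith [Nat.mul_le_mul_right D hD']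

theorem card_mul_le_mul_sum {M : Multiset ℕ} {u c : ℕ} (h : ∀ a ∈ M, u ≤ c * a) :
    M.card * u ≤ c * M.sum := by
  induction M using Multiset.induction_on with
  | empty => simp
  | cons a M ih =>
    have ih' := ih (fun x hx => h x (Multiset.mem_cons_of_mem hx))
    have ha := h a (Multiset.mem_cons_self _ _)
    simp only [Multiset.card_cons, Multiset.sum_cons]
    nlinarith

theorem rho_dominates_of_parts {m k : ℕ} (hm : 100000 ≤ m) (hk : m ≤ 2 * k + 1)
    (hk' : 2 * k ≤ m + 1) {A B R : Multiset ℕ} (hs : (A + (B + R)).sum = tri k)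
    (hA : ∀ a ∈ A, 101 * m ≤ 200 * a) (hB : ∀ a ∈ B, 11 * m ≤ 50 * a)
    (hAs : 716 * (m * m) ≤ 10000 * A.sum) (hR : 50000 * R.card ≤ 7 * m) :
    Dominates (rho k) (conjFun (A + (B + R))) := by
  have hT := two_mul_tri k
  have hkk : 4 * (k * k) ≤ m * m + 2 * m + 1 := by nlinarith
  have hmm : 100000 * m ≤ m * m := Nat.mul_le_mul_right m hm
  apply rho_dominates_of_card_le hs
  · intro a ha; have := hA a ha; omega
  · omega
  · have c1 := card_mul_le_mul_sum hA
    have c2 := card_mul_le_mul_sum hB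
    rw [Multiset.sum_add, Multiset.sum_add] at hs
    rw [Multiset.card_add, Multiset.card_add]
    refine Nat.le_of_mul_le_mul_left ?_ (show 0 < 1111 * m by omega)
    have c3 := Nat.mul_le_mul_right m hR
    have c4 : m * m ≤ 2 * (k * m) + m := by nlinarith
    have c5 := Nat.zero_le R.sum
    have c6 : 8 * tri k ≤ m * m + 4 * m + 3 := by omega
    have c7 : 8 * (A.sum + B.sum) ≤ m * m + 4 * m + 3 := by omega
    generalize A.sum = a at *
    generalize B.sum = b at *
    generalize A.card = ca at *
    generalize B.card = cb at *
    generalize R.card = cr at *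
    have d1 : 101 * (ca * m) ≤ 200 * a := by linarith
    have d2 : 11 * (cb * m) ≤ 50 * b := by linarith
    have d3 : 50000 * (cr * m) ≤ 7 * (m * m) := by linarith
    have e1 : 1111 * m * (100 * (ca + (cb + cr))) =
      111100 * (ca * m) + 111100 * (cb * m) + 111100 * (cr * m) := by ring
    have e2 : 1111 * m * (78 * k) = 86658 * (k * m) := by ring
    rw [e1, e2]
    omega

theorem dominates_rho_of_parts {m k : ℕ} (hm : 100000 ≤ m) (hk : m ≤ 2 * k + 2)
    {S X : Multiset ℕ} (hs : (S + X).sum = tri k)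
    (hS : ∀ a ∈ S, 50 * a ≤ 11 * m) (hX : ∀ a ∈ X, 20 * a ≤ 7 * m)
    (hXs : 1000 * X.sum ≤ 26 * (m * m)) :
    Dominates (conjFun (S + X)) (rho k) := by
  apply dominates_rho_of_small (by omega) hs
  · intro a ha; have := hS a ha; omega
  · intro a ha; have := hX a ha; omega
  · have hmm : 100000 * m ≤ m * m := Nat.mul_le_mul_right m hm
    have : m * m ≤ 4 * (k * k) + 4 * m := by nlinarith
    omega

/-- The conditions on the multiset of parts of a partition of `tri m` under which a good
decomposition is constructed. -/
structure GoodParts (m : ℕ) (P : Multiset ℕ) : Prop where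
  small_lower : m * m ≤ 10 * (P.filter (fun a => 50 * a < 11 * m)).sum
  small_upper : 10000 * (P.filter (fun a => 50 * a < 11 * m)).sum ≤ 1235 * (m * m)
  mid_lower : 15 * (m * m) ≤ 100 * (P.filter (fun a => 20 * a < 7 * m)).sum
  large_upper : 1000 * (P.filter (fun a => 200 * a < 101 * m)).sum ≤ 282 * (m * m)
  parts_le : ∀ a ∈ P, 1000 * a ≤ m * m
  missing_le : 4 * ((Finset.Icc 1 (m / 500)).filter (· ∉ P)).card ≤ m / 500
  missing_le' : 4 * ((Finset.Icc 1 (m / 50000)).filter (· ∉ P)).card ≤ m / 50000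

theorem tri_split {m : ℕ} (hm : 1 ≤ m) :
    tri ((m + 1) / 2) + tri (m / 2) + tri (m / 2) + tri ((m - 1) / 2) = tri m := by
  have h0 := two_mul_tri m
  have h1 := two_mul_tri ((m + 1) / 2)
  have h2 := two_mul_tri (m / 2)
  have h3 := two_mul_tri ((m - 1) / 2)
  rcases Nat.even_or_odd' m with ⟨j, rfl | rfl⟩
  · have e1 : (2 * j + 1) / 2 = j := by omega
    have e2 : 2 * j / 2 = j := by omega
    have e3 : (2 * j - 1) / 2 = j - 1 := by omega
    rw [e1] at h1; rw [e2] at h2; rw [e3] at h3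
    rw [e1, e2, e3]
    obtain ⟨i, rfl⟩ : ∃ i, j = i + 1 := ⟨j - 1, by omega⟩
    simp only [Nat.add_sub_cancel] at *
    nlinarith
  · have e1 : (2 * j + 1 + 1) / 2 = j + 1 := by omega
    have e2 : (2 * j + 1) / 2 = j := by omega
    have e3 : (2 * j + 1 - 1) / 2 = j := by omega
    rw [e1] at h1; rw [e2] at h2; rw [e3] at h3
    rw [e1, e2, e3]
    nlinarith

set_option maxHeartbeats 4000000 in
/-- A partition whose conjugate has well-distributed part sizes is good: the three larger pieces
share the large parts, the last piece takes the small ones, and the consecutive pairs of small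
sizes correct the four totals. -/
theorem goodDecomp_conjFun {m : ℕ} (hm : 10 ^ 12 ≤ m) {P : Multiset ℕ} (hP : P.sum = tri m)
    (h : GoodParts m P) : GoodDecomp m (conjFun P) := by
  have m5 : 100000 ≤ m := by omega
  have k1 : m ≤ 2 * ((m + 1) / 2) + 1 := by omega
  have k1' : 2 * ((m + 1) / 2) ≤ m + 1 := by omega
  have k2 : m ≤ 2 * (m / 2) + 1 := by omega
  have k2' : 2 * (m / 2) ≤ m + 1 := by omega
  have k4 : m ≤ 2 * ((m - 1) / 2) + 2 := by omega
  obtain ⟨F, J₁, J₂, J₄, hRes, cJ₁, cJ₂, cJ₄, cF, hF, hJ₁, hJ₂, hJ₄, sF⟩ :=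
    exists_reserve P (m / 50000) (m / 500) (by omega) (by omega) h.missing_le h.missing_le'
  set D := m / 50000 with hD
  set K := m / 500 with hK
  set Rs : Multiset ℕ := F.val + ((J₁.val + J₁.val.map (· + 1)) + (J₂.val + J₂.val.map (· + 1)) +
        (J₄.val + J₄.val.map (· + 1))) with hRs
  -- splitting by size
  set S := P.filter (fun a => 50 * a < 11 * m) with hS
  set BL := P.filter (fun a => ¬ 50 * a < 11 * m ∧ 20 * a < 7 * m) with hBL
  set BH := P.filter (fun a => ¬ 20 * a < 7 * m ∧ 200 * a < 101 * m) with hBH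
  set A := P.filter (fun a => ¬ 200 * a < 101 * m) with hA
  have eL : P.filter (fun a => 20 * a < 7 * m) = S + BL :=
    filter_split P _ _ (fun a ha => by omega)
  have eM : P.filter (fun a => 200 * a < 101 * m) = S + BL + BH := by
    rw [← eL]; exact filter_split P _ _ (fun a ha => by omega)
  have eP : P = S + BL + BH + A := by
    rw [← eM]; exact (Multiset.filter_add_not _ P).symm
  have memJ : ∀ J : Finset ℕ, (∀ a ∈ J, a + 1 ≤ K) → ∀ a ∈ J.val + J.val.map (· + 1), a ≤ K := by
    intro J hJ a ha
    rcases Multiset.mem_add.1 ha with ha | ha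
    · have := hJ a ha; omega
    · obtain ⟨b, hb, rfl⟩ := Multiset.mem_map.1 ha
      exact hJ b hb
  have hRsK : ∀ a ∈ Rs, a ≤ K := by
    intro a ha
    simp only [hRs, Multiset.mem_add (s := F.val),
      Multiset.mem_add (s := (J₁.val + J₁.val.map (· + 1)) + (J₂.val + J₂.val.map (· + 1))),
      Multiset.mem_add (s := (J₁.val + J₁.val.map (· + 1)))] at ha
    rcases ha with ha | (ha | ha) | ha
    · have := hF a ha; omega
    · exact memJ J₁ hJ₁ a ha
    · exact memJ J₂ hJ₂ a ha
    · exact memJ J₄ hJ₄ a ha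
  have hRsS : Rs ≤ S := Multiset.le_filter.2 ⟨hRes, fun a ha => by have := hRsK a ha; omega⟩
  obtain ⟨S', hS'⟩ := exists_add_of_le hRsS
  have memS : ∀ a ∈ S, 50 * a ≤ 11 * m := fun a ha => by
    have := (Multiset.mem_filter.1 ha).2; omega
  have memBL : ∀ a ∈ BL, 11 * m ≤ 50 * a ∧ 20 * a ≤ 7 * m := fun a ha => by
    have := (Multiset.mem_filter.1 ha).2; omega
  have memBH : ∀ a ∈ BH, 11 * m ≤ 50 * a ∧ 200 * a ≤ 101 * m := fun a ha => by
    have := (Multiset.mem_filter.1 ha).2; omega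
  have memA : ∀ a ∈ A, 101 * m ≤ 200 * a := fun a ha => by
    have := (Multiset.mem_filter.1 ha).2; omega
  have memA' : ∀ a ∈ A, a ≤ m * m / 1000 := fun a ha => by
    have := h.parts_le a (Multiset.mem_filter.1 ha).1; omega
  -- sizes
  have h1 := h.small_lower
  have h2 := h.small_upper
  have h3 := h.mid_lower
  have h4 := h.large_upper
  rw [eL] at h3
  rw [eM] at h4
  have hPs : S.sum + BL.sum + BH.sum + A.sum = tri m := by
    rw [← hP]; conv_rhs => rw [eP]
    simp only [Multiset.sum_add]
  simp only [← hS, Multiset.sum_add] at h1 h2 h3 h4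
  have hSs : S.sum = Rs.sum + S'.sum := by rw [hS', Multiset.sum_add]
  have hmm : 10 ^ 12 * m ≤ m * m := Nat.mul_le_mul_right m hm
  have hT := two_mul_tri m
  have hTs := tri_split (m := m) (by omega)
  have hRcard : Rs.card ≤ 7 * D := by
    simp only [hRs, Multiset.card_add, Multiset.card_map, Finset.card_val]
    omega
  have hRsum : 1000000 * Rs.sum ≤ m * m := by
    have e1 : Rs.sum ≤ Rs.card * K := by
      have := Multiset.sum_le_card_nsmul Rs K hRsK
      simpa using this
    have e2 : Rs.card * K ≤ 7 * D * K := Nat.mul_le_mul_right K hRcard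
    have e3 : 50000 * D * (500 * K) ≤ m * m := Nat.mul_le_mul (by omega) (by omega)
    nlinarith
  have hFs : 3 * m + 3 ≤ F.val.sum := by
    have e1 : m ≤ 50001 * D := by omega
    have e2 : 12 * 50001 + 12 ≤ D := by omega
    have e3 := Nat.mul_le_mul_right D e2
    nlinarith
  set N₁ := tri ((m + 1) / 2) with hN₁
  set N₂ := tri (m / 2) with hN₂
  set N₄ := tri ((m - 1) / 2) with hN₄
  have tb : ∀ k, 2 * k ≤ m + 1 → 8 * tri k ≤ m * m + 4 * m + 3 := by
    intro k hk
    have := two_mul_tri k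
    nlinarith
  have tb' : ∀ k, m ≤ 2 * k + 2 → m * m ≤ 8 * tri k + 2 * m := by
    intro k hk
    have := two_mul_tri k
    nlinarith
  have b1 := tb ((m + 1) / 2) (by omega)
  have b1' := tb' ((m + 1) / 2) (by omega)
  have b2 := tb (m / 2) (by omega)
  have b2' := tb' (m / 2) (by omega)
  have b4 := tb ((m - 1) / 2) (by omega)
  have b4' := tb' ((m - 1) / 2) (by omega)
  rw [← hN₁] at b1 b1'
  rw [← hN₂] at b2 b2'
  rw [← hN₄] at b4 b4'
  have rs : Rs.sum = F.val.sum + ((J₁.val + J₁.val.map (· + 1)).sum +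
      (J₂.val + J₂.val.map (· + 1)).sum + (J₄.val + J₄.val.map (· + 1)).sum) := by
    simp only [hRs, Multiset.sum_add]
  have q1 : J₁.val.sum ≤ (J₁.val + J₁.val.map (· + 1)).sum := by simp
  have q2 : J₂.val.sum ≤ (J₂.val + J₂.val.map (· + 1)).sum := by simp
  have q4 : J₄.val.sum ≤ (J₄.val + J₄.val.map (· + 1)).sum := by simp
  obtain ⟨C, hC, hAC⟩ : ∃ C, 1000 * C ≤ m * m ∧ ∀ a ∈ A, a ≤ C :=
    ⟨m * m / 1000, Nat.mul_div_le _ _, memA'⟩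
  have D₁ : 50000 * D ≤ m := Nat.mul_div_le _ _
  have D₂ : m < 50000 * (D + 1) := Nat.lt_mul_div_succ _ (by norm_num)
  have n1 : N₁ = tri ((m + 1) / 2) := hN₁
  have n2 : N₂ = tri (m / 2) := hN₂
  have n4 : N₄ = tri ((m - 1) / 2) := hN₄
  clear_value N₁ N₂ N₄
  clear hD hK
  clear_value D K
  clear_value S BL BH A Rs
  -- naming the sum keeps the linear arithmetic below from looking inside it
  obtain ⟨σ, hσ⟩ : ∃ σ : Multiset ℕ →+ ℕ, ∀ M, M.sum = σ M :=
    ⟨Multiset.sumAddMonoidHom, fun _ => rfl⟩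
  have near : ∀ (M : Multiset ℕ) (b t : ℕ), (∀ a ∈ M, a ≤ b) → t ≤ σ M →
      ∃ U V, M = U + V ∧ σ U ≤ t ∧ t ≤ σ U + b := by
    simpa only [hσ] using exists_le_sum_near
  have flip : ∀ (J : Finset ℕ) (g : ℕ), g ≤ J.card → ∃ U V : Multiset ℕ,
      J.val + J.val.map (· + 1) = U + V ∧ σ U = σ J.val + g := by
    simpa only [hσ] using exists_flip
  rw [hσ] at hP
  simp only [hσ] at hPs h1 h2 h3 h4 hSs hRsum hFs rs q1 q2 q4
  obtain ⟨tA, htA, htA'⟩ : ∃ t, 3 * t ≤ σ A ∧ σ A < 3 * (t + 1) :=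
    ⟨σ A / 3, Nat.mul_div_le _ _, Nat.lt_mul_div_succ _ (by norm_num)⟩
  -- the largest parts are shared out evenly
  obtain ⟨A₁, A', eA, hA1, hA1'⟩ := near A C tA hAC (by linarith)
  have sA : σ A = σ A₁ + σ A' := by rw [eA, map_add]
  obtain ⟨A₂, A₃, eA', hA2, hA2'⟩ := near A' C tA
    (fun a ha => hAC a (by rw [eA]; exact Multiset.mem_add.2 (Or.inr ha))) (by linarith)
  have sA' : σ A' = σ A₂ + σ A₃ := by rw [eA', map_add]
  -- medium parts
  obtain ⟨t₄, ht₄⟩ : ∃ t, N₄ = σ S' + σ J₄.val + t :=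
    Nat.exists_eq_add_of_le (by linarith)
  obtain ⟨X, BL', eX, hX, hX'⟩ := near BL m t₄
    (fun a ha => by have := (memBL a ha).2; linarith only [this]) (by linarith)
  have sX : σ BL = σ X + σ BL' := by rw [eX, map_add]
  have memB : ∀ a ∈ BL' + BH, 11 * m ≤ 50 * a ∧ a ≤ m := by
    intro a ha
    rcases Multiset.mem_add.1 ha with ha | ha
    · obtain ⟨h, h'⟩ := memBL a (by rw [eX]; exact Multiset.mem_add.2 (Or.inr ha))
      exact ⟨h, by linarith only [h']⟩
    · obtain ⟨h, h'⟩ := memBH a ha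
      exact ⟨h, by linarith only [h']⟩
  have sB0 : σ (BL' + BH) = σ BL' + σ BH := map_add σ _ _
  obtain ⟨t₁, ht₁⟩ : ∃ t, N₁ = σ A₁ + σ J₁.val + t :=
    Nat.exists_eq_add_of_le (by linarith)
  obtain ⟨B₁, B', eB, hB1, hB1'⟩ := near (BL' + BH) m t₁
    (fun a ha => (memB a ha).2) (by linarith)
  have sB : σ (BL' + BH) = σ B₁ + σ B' := by rw [eB, map_add]
  obtain ⟨t₂, ht₂⟩ : ∃ t, N₂ = σ A₂ + σ J₂.val + t :=
    Nat.exists_eq_add_of_le (by linarith)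
  obtain ⟨B₂, B₃, eB', hB2, hB2'⟩ := near B' m t₂
    (fun a ha => (memB a (by rw [eB]; exact Multiset.mem_add.2 (Or.inr ha))).2) (by linarith)
  have sB' : σ B' = σ B₂ + σ B₃ := by rw [eB', map_add]
  -- fine adjustment
  obtain ⟨u₁, hu₁⟩ : ∃ t, N₁ = σ A₁ + σ J₁.val + σ B₁ + t :=
    Nat.exists_eq_add_of_le (by linarith)
  obtain ⟨F₁, F', eF, hF1, hF1'⟩ := near F.val D u₁ hF (by linarith)
  have sF1 : σ F.val = σ F₁ + σ F' := by rw [eF, map_add]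
  have hF'' : ∀ a ∈ F', a ≤ D := fun a ha => hF a (by
    rw [← Finset.mem_val, eF]; exact Multiset.mem_add.2 (Or.inr ha))
  obtain ⟨u₂, hu₂⟩ : ∃ t, N₂ = σ A₂ + σ J₂.val + σ B₂ + t :=
    Nat.exists_eq_add_of_le (by linarith)
  obtain ⟨F₂, F'', eF', hF2, hF2'⟩ := near F' D u₂ hF'' (by linarith)
  have sF2 : σ F' = σ F₂ + σ F'' := by rw [eF', map_add]
  obtain ⟨u₄, hu₄⟩ : ∃ t, N₄ = σ S' + σ J₄.val + σ X + t :=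
    Nat.exists_eq_add_of_le (by linarith)
  obtain ⟨F₄, F₃, eF'', hF4, hF4'⟩ := near F'' D u₄
    (fun a ha => hF'' a (by rw [eF']; exact Multiset.mem_add.2 (Or.inr ha))) (by linarith)
  have sF3 : σ F'' = σ F₄ + σ F₃ := by rw [eF'', map_add]
  obtain ⟨v₁, hv₁⟩ : ∃ t, N₁ = σ A₁ + σ J₁.val + σ B₁ + σ F₁ + t :=
    Nat.exists_eq_add_of_le (by linarith)
  obtain ⟨U₁, V₁, eU₁, sU₁⟩ := flip J₁ v₁ (by linarith)
  obtain ⟨v₂, hv₂⟩ : ∃ t, N₂ = σ A₂ + σ J₂.val + σ B₂ + σ F₂ + t :=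
    Nat.exists_eq_add_of_le (by linarith)
  obtain ⟨U₂, V₂, eU₂, sU₂⟩ := flip J₂ v₂ (by linarith)
  obtain ⟨v₄, hv₄⟩ : ∃ t, N₄ = σ S' + σ J₄.val + σ X + σ F₄ + t :=
    Nat.exists_eq_add_of_le (by linarith)
  obtain ⟨U₄, V₄, eU₄, sU₄⟩ := flip J₄ v₄ (by linarith)
  have eRs : Rs = F₁ + F₂ + (F₄ + F₃) + (U₁ + V₁ + (U₂ + V₂) + (U₄ + V₄)) := by
    rw [hRs, eU₁, eU₂, eU₄, eF, eF', eF'']; abel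
  have g1 : σ (A₁ + (B₁ + (F₁ + U₁))) = N₁ := by
    simp only [map_add]; linarith
  have g2 : σ (A₂ + (B₂ + (F₂ + U₂))) = N₂ := by
    simp only [map_add]; linarith
  have g4 : σ (S' + F₄ + U₄ + X) = N₄ := by
    simp only [map_add]; linarith
  have eAll : P = (A₁ + (B₁ + (F₁ + U₁))) + (A₂ + (B₂ + (F₂ + U₂))) +
      (A₃ + (B₃ + (F₃ + V₁ + V₂ + V₄))) + (S' + F₄ + U₄ + X) := by
    have : P = Rs + S' + X + (BL' + BH) + A := by
      conv_lhs => rw [eP, hS', eX]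
      abel
    rw [this, eRs, eB, eB', eA, eA']
    abel
  have g3 : σ (A₃ + (B₃ + (F₃ + V₁ + V₂ + V₄))) = N₂ := by
    have hsum := congrArg σ eAll
    rw [map_add, map_add, map_add, g1, g2, g4, hP] at hsum
    linarith
  have cRs := hRcard
  rw [eRs] at cRs
  simp only [Multiset.card_add] at cRs
  have pA : ∀ {Q : Multiset ℕ}, Q ≤ A → ∀ a ∈ Q, 101 * m ≤ 200 * a := fun hQ a ha =>
    memA a (Multiset.mem_of_le hQ ha)
  have pB : ∀ {Q : Multiset ℕ}, Q ≤ BL' + BH → ∀ a ∈ Q, 11 * m ≤ 50 * a := fun hQ a ha =>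
    (memB a (Multiset.mem_of_le hQ ha)).1
  have lA1 : A₁ ≤ A := by rw [eA]; exact Multiset.le_add_right _ _
  have lA' : A' ≤ A := by rw [eA]; exact Multiset.le_add_left _ _
  have lA2 : A₂ ≤ A := le_trans (by rw [eA']; exact Multiset.le_add_right _ _) lA'
  have lA3 : A₃ ≤ A := le_trans (by rw [eA']; exact Multiset.le_add_left _ _) lA'
  have lB1 : B₁ ≤ BL' + BH := by rw [eB]; exact Multiset.le_add_right _ _
  have lB' : B' ≤ BL' + BH := by rw [eB]; exact Multiset.le_add_left _ _
  have lB2 : B₂ ≤ BL' + BH := le_trans (by rw [eB']; exact Multiset.le_add_right _ _) lB'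
  have lB3 : B₃ ≤ BL' + BH := le_trans (by rw [eB']; exact Multiset.le_add_left _ _) lB'
  refine ⟨_, _, _, _, isPtnFun_conjFun (A₁ + (B₁ + (F₁ + U₁))),
    isPtnFun_conjFun (A₂ + (B₂ + (F₂ + U₂))),
    isPtnFun_conjFun (A₃ + (B₃ + (F₃ + V₁ + V₂ + V₄))), isPtnFun_conjFun (S' + F₄ + U₄ + X),
    (psize_conjFun _).trans (((hσ _).trans g1).trans n1),
    (psize_conjFun _).trans (((hσ _).trans g2).trans n2),
    (psize_conjFun _).trans (((hσ _).trans g3).trans n2),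
    (psize_conjFun _).trans (((hσ _).trans g4).trans n4),
    Or.inr ?_, Or.inr ?_, Or.inr ?_, Or.inl ?_, ?_⟩
  · exact rho_dominates_of_parts (m := m) m5 k1 k1' (((hσ _).trans g1).trans n1)
      (pA lA1) (pB lB1) (by rw [hσ]; linarith) (by rw [Multiset.card_add]; linarith)
  · exact rho_dominates_of_parts (m := m) m5 k2 k2' (((hσ _).trans g2).trans n2)
      (pA lA2) (pB lB2) (by rw [hσ]; linarith) (by rw [Multiset.card_add]; linarith)
  · exact rho_dominates_of_parts (m := m) m5 k2 k2' (((hσ _).trans g3).trans n2)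
      (pA lA3) (pB lB3) (by rw [hσ]; linarith) (by simp only [Multiset.card_add]; linarith)
  · refine dominates_rho_of_parts (m := m) m5 k4 (((hσ _).trans g4).trans n4) ?_ ?_
      (by rw [hσ]; linarith)
    · have lS : S' + F₄ + U₄ ≤ S := by
        rw [hS', eRs, Multiset.le_iff_exists_add]
        exact ⟨F₁ + F₂ + F₃ + (U₁ + V₁ + (U₂ + V₂) + V₄), by abel⟩
      exact fun a ha => memS a (Multiset.mem_of_le lS ha)
    · exact fun a ha => (memBL a (by rw [eX]; exact Multiset.mem_add.2 (Or.inl ha))).2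
  · conv_lhs => rw [eAll]
    simp only [conjFun_add]

theorem conjFun_eq_add_count (M : Multiset ℕ) (j : ℕ) :
    conjFun M j = conjFun M (j + 1) + M.count (j + 1) := by
  induction M using Multiset.induction_on with
  | empty => simp [conjFun]
  | cons a M ih =>
    simp only [conjFun, Multiset.countP_cons, Multiset.count_cons] at ih ⊢
    split_ifs <;> omega

theorem eq_of_conjFun_eq {M N : Multiset ℕ} (hM : ∀ a ∈ M, 0 < a) (hN : ∀ a ∈ N, 0 < a)
    (h : conjFun M = conjFun N) : M = N := by
  ext j
  rcases j with _ | j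
  · rw [Multiset.count_eq_zero_of_notMem fun h0 => (hM 0 h0).false,
      Multiset.count_eq_zero_of_notMem fun h0 => (hN 0 h0).false]
  · have h1 := conjFun_eq_add_count M j
    have h2 := conjFun_eq_add_count N j
    rw [h] at h1
    omega

theorem exists_conjFun_eq {f : ℕ → ℕ} (hf : IsPtnFun f) :
    ∃ M : Multiset ℕ, (∀ a ∈ M, 0 < a) ∧ conjFun M = f := by
  obtain ⟨hf, N, hN⟩ := hf
  refine ⟨∑ j ∈ Finset.range N, Multiset.replicate (f j - f (j + 1)) (j + 1), ?_, ?_⟩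
  · intro a ha
    obtain ⟨j, -, hj⟩ := Multiset.mem_sum.1 ha
    rw [Multiset.eq_of_mem_replicate hj]
    omega
  · funext r
    have key : ∀ k, f (r + k) + conjFun (∑ j ∈ Finset.range (r + k),
        Multiset.replicate (f j - f (j + 1)) (j + 1)) r = f r := by
      intro k
      induction k with
      | zero =>
        rw [conjFun, Multiset.countP_eq_zero.2]
        · simp
        · intro a ha
          obtain ⟨j, hj, hj'⟩ := Multiset.mem_sum.1 ha
          rw [Multiset.eq_of_mem_replicate hj']
          have := Finset.mem_range.1 hj
          omega
      | succ k ih =>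
        rw [← add_assoc, Finset.sum_range_succ, conjFun_add]
        have h1 : conjFun (Multiset.replicate (f (r + k) - f (r + k + 1)) (r + k + 1)) r =
            f (r + k) - f (r + k + 1) := by
          rw [conjFun, Multiset.countP_eq_card_filter, Multiset.filter_eq_self.2,
            Multiset.card_replicate]
          intro a ha
          rw [Multiset.eq_of_mem_replicate ha]
          omega
        have h2 : f (r + k + 1) ≤ f (r + k) := hf (by omega)
        simp only [Pi.add_apply, h1]
        omega
    rcases le_total r N with h | h
    · obtain ⟨k, rfl⟩ := Nat.exists_eq_add_of_le h
      have := key k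
      rw [hN _ le_rfl] at this
      omega
    · rw [hN r h, conjFun, Multiset.countP_eq_zero.2]
      intro a ha
      obtain ⟨j, hj, hj'⟩ := Multiset.mem_sum.1 ha
      rw [Multiset.eq_of_mem_replicate hj']
      have := Finset.mem_range.1 hj
      omega

/-- Conjugation identifies partitions of `n` with their sequences of parts. -/
noncomputable def partitionEquiv (n : ℕ) :
    n.Partition ≃ {f : ℕ → ℕ // IsPtnFun f ∧ psize f = n} :=
  Equiv.ofBijective
    (fun p => ⟨conjFun p.parts, isPtnFun_conjFun _, (psize_conjFun _).trans p.parts_sum⟩)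
    ⟨fun p q h => Nat.Partition.ext (eq_of_conjFun_eq (fun _ => p.parts_pos) (fun _ => q.parts_pos)
      (congrArg Subtype.val h)), fun ⟨f, hf, hn⟩ => by
      obtain ⟨M, hM, rfl⟩ := exists_conjFun_eq hf
      exact ⟨⟨M, fun {a} => hM a, (psize_conjFun M).symm.trans hn⟩, rfl⟩⟩

theorem natCard_ptn (n : ℕ) :
    Nat.card {f : ℕ → ℕ // IsPtnFun f ∧ psize f = n} = Fintype.card n.Partition := by
  rw [← Nat.card_congr (partitionEquiv n), Nat.card_eq_fintype_card]

theorem natCard_good_le (m : ℕ) :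
    Nat.card {f : ℕ → ℕ // IsPtnFun f ∧ psize f = tri m ∧ GoodDecomp m f} ≤
      Nat.card {f : ℕ → ℕ // IsPtnFun f ∧ psize f = tri m} := by
  have : Finite {f : ℕ → ℕ // IsPtnFun f ∧ psize f = tri m} :=
    Finite.of_equiv _ (partitionEquiv (tri m))
  exact Nat.card_le_card_of_injective (fun f => ⟨f.1, f.2.1, f.2.2.1⟩)
    fun f g h => Subtype.ext (by simpa using h)

open Classical in
theorem card_goodParts_le {m : ℕ} (hm : 10 ^ 12 ≤ m) :
    (Finset.univ.filter fun p : (tri m).Partition => GoodParts m p.parts).card ≤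
      Nat.card {f : ℕ → ℕ // IsPtnFun f ∧ psize f = tri m ∧ GoodDecomp m f} := by
  have : Finite {f : ℕ → ℕ // IsPtnFun f ∧ psize f = tri m} :=
    Finite.of_equiv _ (partitionEquiv (tri m))
  have : Finite {f : ℕ → ℕ // IsPtnFun f ∧ psize f = tri m ∧ GoodDecomp m f} :=
    Finite.of_injective (β := {f : ℕ → ℕ // IsPtnFun f ∧ psize f = tri m})
      (fun f => ⟨f.1, f.2.1, f.2.2.1⟩) fun f g h => Subtype.ext (by simpa using h)
  rw [← Fintype.card_subtype, ← Nat.card_eq_fintype_card]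
  refine Nat.card_le_card_of_injective
    (fun p => ⟨conjFun p.1.parts, (partitionEquiv _ p.1).2.1, (partitionEquiv _ p.1).2.2,
      goodDecomp_conjFun hm p.1.parts_sum p.2⟩) fun p q h => Subtype.ext ?_
  exact (partitionEquiv _).injective (Subtype.ext (Subtype.mk.inj h))

/-- The Euler product of the Boltzmann measure on partitions is at most `exp (ζ(2) / s)`. -/
theorem prod_inv_one_sub_exp_le {s : ℝ} (hs : 0 < s) (N : ℕ) :
    ∏ j ∈ Finset.Icc 1 N, (1 - Real.exp (-(s * j)))⁻¹ ≤ Real.exp (Real.pi ^ 2 / 6 / s) := by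
  have hpos : ∀ j ∈ Finset.Icc 1 N, 0 < 1 - Real.exp (-(s * j)) := fun j hj => by
    have : (1 : ℝ) ≤ j := by exact_mod_cast (Finset.mem_Icc.1 hj).1
    rw [sub_pos, Real.exp_lt_one_iff]
    nlinarith
  have hlt : ∀ j ∈ Finset.Icc 1 N, |Real.exp (-(s * j))| < 1 := fun j hj => by
    rw [abs_of_pos (Real.exp_pos _)]; linarith [hpos j hj]
  have h1 : HasSum (fun i : ℕ => ∑ j ∈ Finset.Icc 1 N, Real.exp (-(s * j)) ^ (i + 1) / (i + 1))
      (∑ j ∈ Finset.Icc 1 N, -Real.log (1 - Real.exp (-(s * j)))) :=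
    hasSum_sum fun j hj => Real.hasSum_pow_div_log_of_abs_lt_one (hlt j hj)
  have h2 : HasSum (fun i : ℕ => (1 : ℝ) / ((i + 1 : ℕ) : ℝ) ^ 2 / s) (Real.pi ^ 2 / 6 / s) := by
    have := (hasSum_nat_add_iff' 1).2 hasSum_zeta_two
    simp only [Finset.range_one, Finset.sum_singleton, Nat.cast_zero, ne_eq, OfNat.ofNat_ne_zero,
      not_false_eq_true, zero_pow, div_zero, sub_zero] at this
    exact this.div_const s
  have h3 := hasSum_le (fun i => ?_) h1 h2
  · rw [← Real.log_le_iff_le_exp (Finset.prod_pos fun j hj => inv_pos.2 (hpos j hj)),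
      Real.log_prod fun j hj => (inv_pos.2 (hpos j hj)).ne']
    simpa only [Real.log_inv] using h3
  · set r := Real.exp (-(s * (i + 1))) with hr
    have hu : 0 < s * ((i : ℝ) + 1) := by positivity
    have hr1 : r < 1 := by rw [hr, Real.exp_lt_one_iff]; linarith
    have hr0 : 0 < r := Real.exp_pos _
    have e1 : ∑ j ∈ Finset.Icc 1 N, Real.exp (-(s * j)) ^ (i + 1) / ((i : ℝ) + 1) =
        (∑ j ∈ Finset.Icc 1 N, r ^ j) / (i + 1) := by
      rw [Finset.sum_div]
      refine Finset.sum_congr rfl fun j _ => ?_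
      rw [hr, ← Real.exp_nat_mul, ← Real.exp_nat_mul]
      congr 2; push_cast; ring
    have e2 : (1 - r) * ∑ j ∈ Finset.Icc 1 N, r ^ j = r - r ^ (N + 1) := by
      clear * -
      induction N with
      | zero => simp
      | succ N ih => rw [Finset.sum_Icc_succ_top (by omega), mul_add, ih]; ring
    have e3 : s * (i + 1) * r ≤ 1 - r := by
      have h := Real.add_one_le_exp (s * ((i : ℝ) + 1))
      have h' : Real.exp (s * ((i : ℝ) + 1)) * r = 1 := by rw [hr, ← Real.exp_add]; simp
      nlinarith
    have e4 : s * (i + 1) * ∑ j ∈ Finset.Icc 1 N, r ^ j ≤ 1 := by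
      have h0 : 0 ≤ ∑ j ∈ Finset.Icc 1 N, r ^ j := Finset.sum_nonneg fun j _ => by positivity
      have h1 : 0 < r ^ (N + 1) := by positivity
      by_contra! hlt
      have h5 := mul_lt_mul_of_pos_right hlt (sub_pos.2 hr1)
      nlinarith
    rw [e1, div_le_div_iff₀ (by positivity) hs]
    push_cast
    rw [one_div_mul_eq_div, le_div_iff₀ (by positivity)]
    nlinarith [mul_le_mul_of_nonneg_right e4 (by positivity : (0 : ℝ) ≤ (i : ℝ) + 1)]

theorem sum_multiset_filter_eq {n : ℕ} (p : n.Partition) (Q : ℕ → Prop) [DecidablePred Q] :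
    (p.parts.filter Q).sum = ∑ j ∈ Finset.Icc 1 n, if Q j then p.parts.count j * j else 0 := by
  rw [Finset.sum_multiset_count_of_subset (p.parts.filter Q) (Finset.Icc 1 n)]
  · refine Finset.sum_congr rfl fun j _ => ?_
    rw [Multiset.count_filter]
    split_ifs <;> simp
  · intro j hj
    have hj := Multiset.mem_of_mem_filter (Multiset.mem_toFinset.1 hj)
    exact Finset.mem_Icc.2 ⟨p.parts_pos hj,
      (Multiset.single_le_sum (fun x _ => Nat.zero_le x) j hj).trans_eq p.parts_sum⟩

theorem sum_count_mul {n : ℕ} (p : n.Partition) :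
    ∑ j ∈ Finset.Icc 1 n, p.parts.count j * j = n := by
  have := sum_multiset_filter_eq p fun _ => True
  simpa [p.parts_sum] using this.symm

/-- The total weight of the partitions of `n`, for a weight multiplicative over part sizes, is at
most the corresponding Euler product. -/
theorem sum_prod_count_le (n : ℕ) (φ : ℕ → ℕ → ℝ) (hφ : ∀ j x, 0 ≤ φ j x) :
    ∑ p : n.Partition, ∏ j ∈ Finset.Icc 1 n, φ j (p.parts.count j) ≤
      ∏ j ∈ Finset.Icc 1 n, ∑ x ∈ Finset.range (n + 1), φ j x := by
  classical
  rw [Finset.prod_sum]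
  let e : n.Partition → (∀ j ∈ Finset.Icc 1 n, ℕ) := fun p j _ => p.parts.count j
  have he : Function.Injective e := by
    intro p q h
    refine Nat.Partition.ext (Multiset.ext.2 fun j => ?_)
    by_cases hj : j ∈ Finset.Icc 1 n
    · exact congrFun (congrFun h j) hj
    · have : ∀ p : n.Partition, p.parts.count j = 0 := fun p => by
        refine Multiset.count_eq_zero_of_notMem fun h => hj (Finset.mem_Icc.2 ⟨p.parts_pos h, ?_⟩)
        exact (Multiset.single_le_sum (fun x _ => Nat.zero_le x) j h).trans_eq p.parts_sum
      rw [this, this]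
  calc ∑ p : n.Partition, ∏ j ∈ Finset.Icc 1 n, φ j (p.parts.count j)
      = ∑ f ∈ Finset.univ.map ⟨e, he⟩, ∏ x ∈ (Finset.Icc 1 n).attach, φ x.1 (f x.1 x.2) := by
        rw [Finset.sum_map]
        refine Finset.sum_congr rfl fun p _ => ?_
        exact (Finset.prod_attach (Finset.Icc 1 n) fun j => φ j (p.parts.count j)).symm
    _ ≤ _ := by
        refine Finset.sum_le_sum_of_subset_of_nonneg (fun f hf => ?_)
          fun f _ _ => Finset.prod_nonneg fun _ _ => hφ _ _
        obtain ⟨p, -, rfl⟩ := Finset.mem_map.1 hf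
        refine Finset.mem_pi.2 fun j hj => Finset.mem_range_succ_iff.2 ?_
        have h1 := Finset.single_le_sum (f := fun j => p.parts.count j * j)
          (fun _ _ => Nat.zero_le _) hj
        have h2 := (Finset.mem_Icc.1 hj).1
        rw [sum_count_mul p] at h1
        exact (Nat.le_mul_of_pos_right _ h2).trans h1

/-- Exponential Markov inequality for the Boltzmann measure on partitions. -/
theorem card_le_exp {n : ℕ} {s : ℝ} (hs : 0 < s) (B : Finset n.Partition) (ψ : ℕ → ℕ → ℝ)
    (hψ : ∀ j x, 0 ≤ ψ j x) (h : ℝ)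
    (hB : ∀ p ∈ B, Real.exp h ≤ ∏ j ∈ Finset.Icc 1 n, ψ j (p.parts.count j)) (ρ : ℕ → ℝ)
    (hρ : ∀ j ∈ Finset.Icc 1 n, ∑ x ∈ Finset.range (n + 1), ψ j x * Real.exp (-(s * j)) ^ x ≤
      Real.exp (ρ j) * (1 - Real.exp (-(s * j)))⁻¹) :
    (B.card : ℝ) ≤
      Real.exp (s * n + Real.pi ^ 2 / 6 / s - h + ∑ j ∈ Finset.Icc 1 n, ρ j) := by
  have key : (B.card : ℝ) * (Real.exp h * Real.exp (-(s * n))) ≤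
      Real.exp (Real.pi ^ 2 / 6 / s) * Real.exp (∑ j ∈ Finset.Icc 1 n, ρ j) := by
    calc (B.card : ℝ) * (Real.exp h * Real.exp (-(s * n)))
        = ∑ p ∈ B, Real.exp h * Real.exp (-(s * n)) := by rw [Finset.sum_const, nsmul_eq_mul]
      _ ≤ ∑ p ∈ B, ∏ j ∈ Finset.Icc 1 n,
            ψ j (p.parts.count j) * Real.exp (-(s * j)) ^ (p.parts.count j) := by
          refine Finset.sum_le_sum fun p hp => ?_
          have e : ∏ j ∈ Finset.Icc 1 n, Real.exp (-(s * j)) ^ (p.parts.count j) =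
              Real.exp (-(s * n)) := by
            simp only [← Real.exp_nat_mul]
            rw [← Real.exp_sum]
            congr 1
            have := congrArg (fun k : ℕ => -(s * (k : ℝ))) (sum_count_mul p)
            simp only [Nat.cast_sum, Nat.cast_mul] at this
            rw [← this, Finset.mul_sum, ← Finset.sum_neg_distrib]
            exact Finset.sum_congr rfl fun j _ => by ring
          rw [Finset.prod_mul_distrib, e]
          exact mul_le_mul_of_nonneg_right (hB p hp) (Real.exp_pos _).le
      _ ≤ ∑ p : n.Partition, ∏ j ∈ Finset.Icc 1 n,
            ψ j (p.parts.count j) * Real.exp (-(s * j)) ^ (p.parts.count j) :=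
          Finset.sum_le_sum_of_subset_of_nonneg (Finset.subset_univ _) fun p _ _ =>
            Finset.prod_nonneg fun j _ => mul_nonneg (hψ _ _) (by positivity)
      _ ≤ ∏ j ∈ Finset.Icc 1 n, ∑ x ∈ Finset.range (n + 1), ψ j x * Real.exp (-(s * j)) ^ x :=
          sum_prod_count_le n (fun j x => ψ j x * Real.exp (-(s * j)) ^ x) fun j x =>
            mul_nonneg (hψ _ _) (by positivity)
      _ ≤ ∏ j ∈ Finset.Icc 1 n, Real.exp (ρ j) * (1 - Real.exp (-(s * j)))⁻¹ :=
          Finset.prod_le_prod (fun j _ => Finset.sum_nonneg fun x _ =>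
            mul_nonneg (hψ _ _) (by positivity)) hρ
      _ ≤ _ := by
          rw [Finset.prod_mul_distrib, ← Real.exp_sum, mul_comm]
          exact mul_le_mul_of_nonneg_right (prod_inv_one_sub_exp_le hs n) (Real.exp_pos _).le
  rw [← Real.exp_add, ← Real.exp_add] at key
  rw [← le_div_iff₀ (Real.exp_pos _), ← Real.exp_sub] at key
  refine key.trans_eq ?_
  congr 1; ring

theorem sum_range_pow_le {r : ℝ} (h0 : 0 ≤ r) (h1 : r < 1) (N : ℕ) :
    ∑ x ∈ Finset.range N, r ^ x ≤ (1 - r)⁻¹ :=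
  sum_le_hasSum _ (fun _ _ => by positivity) (hasSum_geometric_of_lt_one h0 h1)

theorem exp_neg_lt_one {u : ℝ} (hu : 0 < u) : Real.exp (-u) < 1 :=
  Real.exp_lt_one_iff.2 (neg_lt_zero.2 hu)

theorem sum_exp_tilt_up_le {u : ℝ} (hu : 0 < u) (N : ℕ) :
    ∑ x ∈ Finset.range N, Real.exp (u / 100 * x) * Real.exp (-u) ^ x ≤
      Real.exp (1 / 99) * (1 - Real.exp (-u))⁻¹ := by
  have e : ∀ x : ℕ, Real.exp (u / 100 * x) * Real.exp (-u) ^ x =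
      Real.exp (-(99 / 100 * u)) ^ x := by
    intro x
    rw [← Real.exp_nat_mul, ← Real.exp_nat_mul, ← Real.exp_add]
    congr 1; ring
  simp only [e]
  refine (sum_range_pow_le (Real.exp_pos _).le (exp_neg_lt_one (by positivity)) N).trans ?_
  have h1 := exp_neg_lt_one hu
  have h2 : Real.exp (-(99 / 100 * u)) ≤ 1 / 100 * Real.exp 0 + 99 / 100 * Real.exp (-u) := by
    have := convexOn_exp.2 (Set.mem_univ 0) (Set.mem_univ (-u))
      (by norm_num : (0 : ℝ) ≤ 1 / 100) (by norm_num : (0 : ℝ) ≤ 99 / 100) (by norm_num)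
    simp only [smul_eq_mul] at this
    rwa [show (1 : ℝ) / 100 * 0 + 99 / 100 * -u = -(99 / 100 * u) by ring] at this
  rw [Real.exp_zero] at h2
  have h3 : (100 : ℝ) / 99 ≤ Real.exp (1 / 99) := by
    have := Real.add_one_le_exp (1 / 99 : ℝ)
    linarith
  calc (1 - Real.exp (-(99 / 100 * u)))⁻¹ ≤ (99 / 100 * (1 - Real.exp (-u)))⁻¹ :=
        inv_anti₀ (by linarith) (by linarith)
    _ = 100 / 99 * (1 - Real.exp (-u))⁻¹ := by rw [mul_inv]; norm_num
    _ ≤ _ := mul_le_mul_of_nonneg_right h3 (inv_nonneg.2 (by linarith))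

theorem exp_mul_two_sub_le {u : ℝ} (h0 : 0 < u) (h2 : u < 2) :
    Real.exp u * (2 - u) ≤ 2 + u := by
  have h := Real.hasSum_log_sub_log_of_abs_lt_one (x := u / 2)
    (by rw [abs_of_pos (by linarith)]; linarith)
  have h' := sum_le_hasSum (Finset.range 1) (fun i _ => by positivity) h
  simp only [Finset.range_one, Finset.sum_singleton, Nat.cast_zero] at h'
  rw [← Real.log_div (by linarith) (by linarith), Real.le_log_iff_exp_le
    (div_pos (by linarith) (by linarith)), le_div_iff₀ (by linarith)] at h'
  have e : (2 : ℝ) * (1 / (2 * 0 + 1)) * (u / 2) ^ (2 * 0 + 1) = u := by ring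
  rw [e] at h'
  linarith

theorem sum_exp_tilt_down_le {u : ℝ} (hu : 0 < u) (hu' : 101 * u ≤ 200) (N : ℕ) :
    ∑ x ∈ Finset.range N, Real.exp (-(u / 100) * x) * Real.exp (-u) ^ x ≤
      Real.exp (-(1 / 101) + u / 200) * (1 - Real.exp (-u))⁻¹ := by
  have e : ∀ x : ℕ, Real.exp (-(u / 100) * x) * Real.exp (-u) ^ x =
      Real.exp (-(101 / 100 * u)) ^ x := by
    intro x
    rw [← Real.exp_nat_mul, ← Real.exp_nat_mul, ← Real.exp_add]
    congr 1; ring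
  simp only [e]
  refine (sum_range_pow_le (Real.exp_pos _).le (exp_neg_lt_one (by positivity)) N).trans ?_
  set E := Real.exp u with hE
  set g := Real.exp (-(u / 100)) with hg
  have hg1 : 1 - u / 100 ≤ g := by have := Real.add_one_le_exp (-(u / 100)); linarith
  have hg2 : g ≤ 1 - u / 100 + (u / 100) ^ 2 / 2 := by
    have h := Real.quadratic_le_exp_of_nonneg (x := u / 100) (by positivity)
    have h' : g * Real.exp (u / 100) = 1 := by rw [hg, ← Real.exp_add]; simp
    have hg0 : 0 < g := Real.exp_pos _
    have : g * (1 + u / 100 + (u / 100) ^ 2 / 2) ≤ 1 := by nlinarith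
    have h3 : 1 ≤ (1 - u / 100 + (u / 100) ^ 2 / 2) * (1 + u / 100 + (u / 100) ^ 2 / 2) := by
      nlinarith [sq_nonneg ((u / 100) ^ 2)]
    have h4 : 0 < 1 + u / 100 + (u / 100) ^ 2 / 2 := by positivity
    by_contra! hlt
    nlinarith
  have hE1 : 1 < E := by rw [hE]; exact Real.one_lt_exp_iff.2 hu
  have hE2 : E * (2 - u) ≤ 2 + u := exp_mul_two_sub_le hu (by linarith)
  have e1 : Real.exp (-u) = 1 / E := by rw [hE, Real.exp_neg, one_div]
  have e2 : Real.exp (-(101 / 100 * u)) = g / E := by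
    rw [hE, hg, ← Real.exp_sub]; congr 1; ring
  rw [e1, e2]
  have e3 : (1 - g / E)⁻¹ = (E - 1) / (E - g) * (1 - 1 / E)⁻¹ := by
    have h1 : E - g ≠ 0 := by nlinarith
    have h2 : E - 1 ≠ 0 := by linarith
    have h3 : E ≠ 0 := by linarith
    have h4 : 1 - g / E ≠ 0 := by
      rw [one_sub_div h3]; exact div_ne_zero h1 h3
    have h5 : 1 - 1 / E ≠ 0 := by
      rw [one_sub_div h3]; exact div_ne_zero h2 h3
    field_simp
  rw [e3]
  refine mul_le_mul_of_nonneg_right ?_ (inv_nonneg.2 (by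
    rw [sub_nonneg, div_le_one (by linarith)]; exact hE1.le))
  refine le_trans ?_ (Real.add_one_le_exp _)
  have hgE : 0 < E - g := by nlinarith
  rw [div_le_iff₀ hgE]
  have k1 : (u / 100) * (1 - u / 200) ≤ 1 - g := by nlinarith
  have k2 : (E - 1) * (2 - u) ≤ 2 * u := by nlinarith
  nlinarith

theorem sum_exp_ne_zero_le {u : ℝ} (hu : 0 < u) (N : ℕ) :
    ∑ x ∈ Finset.range (N + 1), (if x = 0 then 0 else 1) * Real.exp (-u) ^ x ≤
      Real.exp (-u) * (1 - Real.exp (-u))⁻¹ := by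
  rw [Finset.sum_range_succ']
  simp only [Nat.add_eq_zero_iff, one_ne_zero, and_false, if_false, one_mul, if_true, zero_mul,
    add_zero, pow_succ']
  rw [← Finset.mul_sum]
  exact mul_le_mul_of_nonneg_left (sum_range_pow_le (Real.exp_pos _).le (exp_neg_lt_one hu) N)
    (Real.exp_pos _).le

theorem sum_exp_eq_zero_le {u : ℝ} (hu : 0 < u) (N : ℕ) :
    ∑ x ∈ Finset.range (N + 1), (if x = 0 then Real.exp 1 else 1) * Real.exp (-u) ^ x ≤
      Real.exp (2 * u) * (1 - Real.exp (-u))⁻¹ := by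
  have h1 := exp_neg_lt_one hu
  have h2 := sum_range_pow_le (Real.exp_pos _).le h1 (N + 1)
  rw [Finset.sum_range_succ'] at h2 ⊢
  simp only [Nat.add_eq_zero_iff, one_ne_zero, and_false, if_false, one_mul, if_true, pow_zero,
    mul_one] at h2 ⊢
  have h3 : 0 < 1 - Real.exp (-u) := by linarith
  have h4 : (1 - Real.exp (-u)) * (1 - Real.exp (-u))⁻¹ = 1 := mul_inv_cancel₀ h3.ne'
  have h5 := Real.add_one_le_exp (2 * u)
  have h6 := Real.add_one_le_exp (-u)
  have h7 := Real.exp_one_lt_d9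
  have h8 : 0 < (1 - Real.exp (-u))⁻¹ := inv_pos.2 h3
  have h9 : 1 + (Real.exp 1 - 1) * (1 - Real.exp (-u)) ≤ Real.exp (2 * u) := by nlinarith
  have := mul_le_mul_of_nonneg_right h9 h8.le
  nlinarith

/-- The constant `π / √3`, for which `tri m` has `exp ((π / √3 + o(1)) * m)` partitions. -/
noncomputable def growth : ℝ := Real.pi / √3

theorem growth_sq : growth ^ 2 = Real.pi ^ 2 / 3 := by
  rw [growth, div_pow, Real.sq_sqrt (by norm_num)]

theorem growth_pos : 0 < growth := by unfold growth; positivity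

theorem growth_gt : 1.8137 < growth := by
  have h := growth_sq
  have h0 := growth_pos
  have := Real.pi_gt_d6
  nlinarith

theorem growth_lt : growth < 1.814 := by
  have h := growth_sq
  have h0 := growth_pos
  have := Real.pi_lt_d6
  have := Real.pi_pos
  nlinarith

theorem cast_tri (m : ℕ) : (tri m : ℝ) = (m ^ 2 + m) / 2 := by
  have h : (2 * tri m : ℝ) = m * m + m := by exact_mod_cast two_mul_tri m
  linarith

theorem boltzmann_exponent_le {m : ℕ} (hm : 1 ≤ m) :
    growth / m * (tri m : ℕ) + Real.pi ^ 2 / 6 / (growth / m) ≤ growth * m + 1 := by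
  have hm' : (1 : ℝ) ≤ m := by exact_mod_cast hm
  have hg := growth_pos
  have e : Real.pi ^ 2 / 6 / (growth / m) = growth * m / 2 := by
    have := growth_sq
    field_simp
    linarith
  rw [e, cast_tri]
  have e' : growth / m * ((m ^ 2 + m) / 2) = growth * m / 2 + growth / 2 := by field_simp
  rw [e']
  have := growth_lt
  linarith

theorem card_le_exp_growth {m : ℕ} (hm : 1 ≤ m) (B : Finset (tri m).Partition) (ψ : ℕ → ℕ → ℝ)
    (hψ : ∀ j x, 0 ≤ ψ j x) (h : ℝ)
    (hB : ∀ p ∈ B, Real.exp h ≤ ∏ j ∈ Finset.Icc 1 (tri m), ψ j (p.parts.count j)) (ρ : ℕ → ℝ)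
    (hρ : ∀ j ∈ Finset.Icc 1 (tri m), 0 < growth / m * j →
      ∑ x ∈ Finset.range (tri m + 1), ψ j x * Real.exp (-(growth / m * j)) ^ x ≤
        Real.exp (ρ j) * (1 - Real.exp (-(growth / m * j)))⁻¹)
    {E : ℝ} (hE : ∑ j ∈ Finset.Icc 1 (tri m), ρ j - h ≤ E) :
    (B.card : ℝ) ≤ Real.exp (growth * m + 1 + E) := by
  have hm' : (0 : ℝ) < m := by exact_mod_cast hm
  have hs : 0 < growth / m := div_pos growth_pos hm'
  refine (card_le_exp hs B ψ hψ h hB ρ fun j hj => hρ j hj ?_).trans (Real.exp_le_exp.2 ?_)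
  · have : (0 : ℝ) < j := by exact_mod_cast (Finset.mem_Icc.1 hj).1
    positivity
  · have := boltzmann_exponent_le hm
    linarith

theorem prod_ite_exp_eq {n : ℕ} (p : n.Partition) (c : ℝ) (Q : ℕ → Prop) [DecidablePred Q] :
    ∏ j ∈ Finset.Icc 1 n, (if Q j then Real.exp (c * j * p.parts.count j) else 1) =
      Real.exp (c * ((p.parts.filter Q).sum : ℕ)) := by
  rw [sum_multiset_filter_eq, Nat.cast_sum, Finset.mul_sum, Real.exp_sum]
  refine Finset.prod_congr rfl fun j _ => ?_
  split_ifs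
  · push_cast; congr 1; ring
  · simp

theorem filter_Icc_mul_lt {c d m : ℕ} (hd : 0 < d) (hdc : d ≤ c) (hm : 1 ≤ m) :
    (Finset.Icc 1 (tri m)).filter (fun j => c * j < d * m) =
      Finset.Icc 1 ((d * m - 1) / c) := by
  ext j
  have hc : 0 < c := by omega
  have hdm : 0 < d * m := by positivity
  simp only [Finset.mem_filter, Finset.mem_Icc, Nat.le_div_iff_mul_le hc]
  have hT := two_mul_tri m
  have hmm : m ≤ m * m := Nat.le_mul_self m
  rw [mul_comm j c]
  constructor
  · rintro ⟨⟨h1, -⟩, h2⟩; omega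
  · rintro ⟨h1, h2⟩
    refine ⟨⟨h1, ?_⟩, by omega⟩
    have h3 : d * m ≤ c * m := Nat.mul_le_mul_right m hdc
    have h4 : j < m := lt_of_mul_lt_mul_left (a := c) (by omega) (Nat.zero_le c)
    omega

theorem card_small_mass_ge_le {c d m : ℕ} (hd : 0 < d) (hdc : d ≤ c) (hm : 1 ≤ m) {μ : ℝ}
    (B : Finset (tri m).Partition)
    (hB : ∀ p ∈ B, μ * m ^ 2 ≤ ((p.parts.filter (fun a => c * a < d * m)).sum : ℕ)) :
    (B.card : ℝ) ≤ Real.exp (growth * m + 1 + (d / c / 99 - growth * μ / 100) * m) := by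
  have hm' : (0 : ℝ) < m := by exact_mod_cast hm
  have hs : 0 < growth / m := div_pos growth_pos hm'
  have hc : (0 : ℝ) < c := by exact_mod_cast (by omega : 0 < c)
  refine card_le_exp_growth hm B
    (fun j x => if c * j < d * m then Real.exp (growth / m / 100 * j * x) else 1)
    (fun j x => by positivity) (growth * μ / 100 * m) (fun p hp => ?_)
    (fun j => if c * j < d * m then 1 / 99 else 0) (fun j hj hu => ?_) ?_
  · rw [prod_ite_exp_eq, Real.exp_le_exp]
    calc growth * μ / 100 * m = growth / m / 100 * (μ * m ^ 2) := by field_simp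
      _ ≤ _ := mul_le_mul_of_nonneg_left (hB p hp) (by positivity)
  · split_ifs
    · have := sum_exp_tilt_up_le hu (tri m + 1)
      convert this using 5
      ring
    · simpa using sum_range_pow_le (Real.exp_pos _).le (exp_neg_lt_one hu) (tri m + 1)
  · rw [← Finset.sum_filter, filter_Icc_mul_lt hd hdc hm, Finset.sum_const, Nat.card_Icc,
      Nat.add_sub_cancel, nsmul_eq_mul]
    have h1 : (((d * m - 1) / c : ℕ) : ℝ) ≤ d / c * m := by
      rw [div_mul_eq_mul_div, le_div_iff₀ hc]
      have : (d * m - 1) / c * c ≤ d * m := (Nat.div_mul_le_self _ _).trans (Nat.sub_le _ _)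
      exact_mod_cast this
    linarith

theorem card_small_mass_le_le {c d m : ℕ} (hd : 0 < d) (hdc : d ≤ c) (hdc' : 2 * d ≤ c)
    (hm : 1 ≤ m) {μ : ℝ} (B : Finset (tri m).Partition)
    (hB : ∀ p ∈ B, ((p.parts.filter (fun a => c * a < d * m)).sum : ℕ) ≤ μ * m ^ 2) :
    (B.card : ℝ) ≤ Real.exp (growth * m + 1 +
      ((growth * μ / 100 - d / c / 101 + growth * (d / c) ^ 2 / 400) * m + 1)) := by
  have hm' : (0 : ℝ) < m := by exact_mod_cast hm
  have hg := growth_pos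
  have hgl := growth_lt
  have hs : 0 < growth / m := div_pos growth_pos hm'
  have hc : (0 : ℝ) < c := by exact_mod_cast (by omega : 0 < c)
  refine card_le_exp_growth hm B
    (fun j x => if c * j < d * m then Real.exp (-(growth / m) / 100 * j * x) else 1)
    (fun j x => by positivity) (-(growth * μ / 100 * m)) (fun p hp => ?_)
    (fun j => if c * j < d * m then -(1 / 101) + growth / m * j / 200 else 0) (fun j hj hu => ?_) ?_
  · rw [prod_ite_exp_eq, Real.exp_le_exp]
    have h1 := mul_le_mul_of_nonneg_left (hB p hp) (by positivity : 0 ≤ growth / m / 100)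
    have h2 : growth / m / 100 * (μ * m ^ 2) = growth * μ / 100 * m := by field_simp
    linarith
  · split_ifs with hj'
    · have h1 : (2 * j : ℝ) ≤ m := by
        have h3 : 2 * d * m ≤ c * m := Nat.mul_le_mul_right m hdc'
        have h4 : c * (2 * j) < c * m := by linarith
        exact_mod_cast (lt_of_mul_lt_mul_left h4 (Nat.zero_le c)).le
      have h2 : 101 * (growth / m * j) ≤ 200 := by
        rw [div_mul_eq_mul_div, ← mul_div_assoc, div_le_iff₀ hm']
        nlinarith
      have := sum_exp_tilt_down_le hu h2 (tri m + 1)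
      convert this using 5
      ring
    · simpa using sum_range_pow_le (Real.exp_pos _).le (exp_neg_lt_one hu) (tri m + 1)
  · rw [← Finset.sum_filter, filter_Icc_mul_lt hd hdc hm]
    set L := (d * m - 1) / c with hL
    have h1 : (L : ℝ) ≤ d / c * m := by
      rw [div_mul_eq_mul_div, le_div_iff₀ hc]
      have : (d * m - 1) / c * c ≤ d * m := (Nat.div_mul_le_self _ _).trans (Nat.sub_le _ _)
      exact_mod_cast this
    have h2 : d / c * m ≤ (L : ℝ) + 1 := by
      rw [div_mul_eq_mul_div, div_le_iff₀ hc]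
      have : d * m - 1 < c * ((d * m - 1) / c + 1) := Nat.lt_mul_div_succ _ (by omega)
      have : d * m ≤ ((d * m - 1) / c + 1) * c := by rw [mul_comm _ c]; omega
      exact_mod_cast this
    have h3 : ∀ L : ℕ, ∑ j ∈ Finset.Icc 1 L, (-(1 / 101) + growth / m * j / 200 : ℝ) =
        -(L / 101) + growth / m * (L * (L + 1)) / 400 := by
      intro L
      induction L with
      | zero => simp
      | succ L ih => rw [Finset.sum_Icc_succ_top (by omega), ih]; push_cast; ring
    rw [h3]
    set θ : ℝ := d / c with hθ
    have hθ0 : 0 < θ := by have : (0 : ℝ) < d := by exact_mod_cast hd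
                           positivity
    have hθ1 : θ ≤ 1 := by rw [hθ, div_le_one hc]; exact_mod_cast hdc
    have h4 : (L : ℝ) * (L + 1) ≤ θ * m * (θ * m + 1) := by
      have : (0 : ℝ) ≤ L := Nat.cast_nonneg L
      gcongr
    have h5 := mul_le_mul_of_nonneg_left h4 hs.le
    have h6 : growth / m * (θ * m * (θ * m + 1)) = growth * θ ^ 2 * m + growth * θ := by field_simp
    rw [h6] at h5
    have h7 : growth * θ ≤ 1.814 := by nlinarith
    linarith

theorem card_large_part_le {m k : ℕ} (hm : 1 ≤ m) (hk : 1 ≤ k) (hk' : k ≤ tri m)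
    (B : Finset (tri m).Partition) (hB : ∀ p ∈ B, k ∈ p.parts) :
    (B.card : ℝ) ≤ Real.exp (growth * m + 1 + -(growth / m * k)) := by
  refine card_le_exp_growth hm B (fun j x => if j = k then (if x = 0 then 0 else 1) else 1)
    (fun j x => by positivity) 0 (fun p hp => ?_)
    (fun j => if j = k then -(growth / m * k) else 0) (fun j hj hu => ?_) ?_
  · rw [Real.exp_zero]
    refine (Finset.prod_eq_one fun j _ => ?_).ge
    split_ifs with h h'
    · subst h
      exact absurd (hB p hp) (Multiset.count_eq_zero.1 h')
    all_goals rfl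
  · split_ifs with h
    · subst h
      exact sum_exp_ne_zero_le hu (tri m)
    · simpa using sum_range_pow_le (Real.exp_pos _).le (exp_neg_lt_one hu) (tri m + 1)
  · rw [Finset.sum_ite_eq' (Finset.Icc 1 (tri m)) k, if_pos (Finset.mem_Icc.2 ⟨hk, hk'⟩), sub_zero]

theorem card_missing_ge_le {m K : ℕ} (hm : 1 ≤ m) (hK : 500 * K ≤ m)
    (B : Finset (tri m).Partition)
    (hB : ∀ p ∈ B, K ≤ 4 * ((Finset.Icc 1 K).filter (· ∉ p.parts)).card) :
    (B.card : ℝ) ≤ Real.exp (growth * m + 1 + -(K / 5 : ℝ)) := by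
  have hm' : (0 : ℝ) < m := by exact_mod_cast hm
  have hg := growth_pos
  have hgl := growth_lt
  have hs : 0 < growth / m := div_pos growth_pos hm'
  have hKn : Finset.Icc 1 K ⊆ Finset.Icc 1 (tri m) := by
    have hT := two_mul_tri m
    have hmm : m ≤ m * m := Nat.le_mul_self m
    exact Finset.Icc_subset_Icc_right (by omega)
  refine card_le_exp_growth hm B
    (fun j x => if j ≤ K then (if x = 0 then Real.exp 1 else 1) else 1)
    (fun j x => by positivity) (K / 4) (fun p hp => ?_)
    (fun j => if j ≤ K then 2 * (growth / m * j) else 0) (fun j hj hu => ?_) ?_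
  · have e : ∏ j ∈ Finset.Icc 1 (tri m),
        (if j ≤ K then (if p.parts.count j = 0 then Real.exp 1 else 1) else 1) =
        Real.exp (((Finset.Icc 1 K).filter (· ∉ p.parts)).card : ℕ) := by
      rw [← Finset.prod_subset hKn (fun j hj hj' => if_neg fun h =>
        hj' (Finset.mem_Icc.2 ⟨(Finset.mem_Icc.1 hj).1, h⟩))]
      rw [Finset.prod_congr rfl fun j hj => if_pos (Finset.mem_Icc.1 hj).2, ← Finset.prod_filter,
        Finset.prod_const, ← Real.exp_nat_mul, mul_one]
      simp only [Multiset.count_eq_zero]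
    rw [e, Real.exp_le_exp]
    have : (K : ℝ) ≤ 4 * (((Finset.Icc 1 K).filter (· ∉ p.parts)).card : ℕ) := by
      exact_mod_cast hB p hp
    linarith
  · split_ifs
    · exact sum_exp_eq_zero_le hu (tri m)
    · simpa using sum_range_pow_le (Real.exp_pos _).le (exp_neg_lt_one hu) (tri m + 1)
  · rw [← Finset.sum_subset hKn (fun j hj hj' => if_neg fun h =>
        hj' (Finset.mem_Icc.2 ⟨(Finset.mem_Icc.1 hj).1, h⟩)),
      Finset.sum_congr rfl fun j hj => if_pos (Finset.mem_Icc.1 hj).2]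
    have h1 : ∑ j ∈ Finset.Icc 1 K, 2 * (growth / m * j) ≤ K * (2 * (growth / 500)) := by
      have := Finset.sum_le_card_nsmul (Finset.Icc 1 K) (fun j : ℕ => 2 * (growth / m * j))
        (2 * (growth / 500)) fun j hj => by
          have h2 : (500 * j : ℝ) ≤ m := by
            have := (Finset.mem_Icc.1 hj).2
            exact_mod_cast (by omega : 500 * j ≤ m)
          rw [div_mul_eq_mul_div]
          have : growth * j / m ≤ growth / 500 := by
            rw [div_le_div_iff₀ hm' (by norm_num)]
            nlinarith
          linarith
      simpa using this
    have h2 : (0 : ℝ) ≤ K := Nat.cast_nonneg K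
    nlinarith

open Classical in
theorem card_not_goodParts_le {m : ℕ} (hm : 10 ^ 12 ≤ m) :
    ((Finset.univ.filter fun p : (tri m).Partition => ¬ GoodParts m p.parts).card : ℝ) ≤
      (6 + tri m) * Real.exp ((growth - 1 / 250000) * m + 3) := by
  have hm1 : 1 ≤ m := by omega
  have hm' : (10 ^ 12 : ℝ) ≤ m := by exact_mod_cast hm
  have hg := growth_gt
  have hgl := growth_lt
  set X := Real.exp ((growth - 1 / 250000) * m + 3) with hX
  let U : Finset (tri m).Partition := Finset.univ
  let B₁ := U.filter fun p => ¬ m * m ≤ 10 * (p.parts.filter (fun a => 50 * a < 11 * m)).sum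
  let B₂ := U.filter fun p =>
    ¬ 10000 * (p.parts.filter (fun a => 50 * a < 11 * m)).sum ≤ 1235 * (m * m)
  let B₃ := U.filter fun p =>
    ¬ 15 * (m * m) ≤ 100 * (p.parts.filter (fun a => 20 * a < 7 * m)).sum
  let B₄ := U.filter fun p =>
    ¬ 1000 * (p.parts.filter (fun a => 200 * a < 101 * m)).sum ≤ 282 * (m * m)
  let B₅ := (Finset.Icc 1 (tri m)).biUnion fun k =>
    U.filter fun p => m * m < 1000 * k ∧ k ∈ p.parts
  let B₆ := U.filter fun p =>
    ¬ 4 * ((Finset.Icc 1 (m / 500)).filter (· ∉ p.parts)).card ≤ m / 500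
  let B₇ := U.filter fun p =>
    ¬ 4 * ((Finset.Icc 1 (m / 50000)).filter (· ∉ p.parts)).card ≤ m / 50000
  have hsub : (Finset.univ.filter fun p : (tri m).Partition => ¬ GoodParts m p.parts) ⊆
      B₁ ∪ (B₂ ∪ (B₃ ∪ (B₄ ∪ (B₅ ∪ (B₆ ∪ B₇))))) := by
    intro p hp
    have hp := (Finset.mem_filter.1 hp).2
    by_contra hcon
    simp only [Finset.mem_union, not_or, Finset.mem_filter, Finset.mem_biUnion, not_and, not_not,
      B₁, B₂, B₃, B₄, B₅, B₆, B₇, U, Finset.mem_univ, true_and, not_exists] at hcon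
    obtain ⟨h1, h2, h3, h4, h5, h6, h7⟩ := hcon
    refine hp ⟨h1, h2, h3, h4, fun a ha => ?_, h6, h7⟩
    by_contra! hlt
    exact h5 a (Finset.mem_Icc.2 ⟨p.parts_pos ha, p.le_of_mem_parts ha⟩) hlt ha
  have hcard : ((Finset.univ.filter fun p : (tri m).Partition => ¬ GoodParts m p.parts).card : ℝ) ≤
      B₁.card + (B₂.card + (B₃.card + (B₄.card + (B₅.card + (B₆.card + B₇.card))))) := by
    have := (Finset.card_le_card hsub).trans ((Finset.card_union_le _ _).trans
      (Nat.add_le_add_left ((Finset.card_union_le _ _).trans (Nat.add_le_add_left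
      ((Finset.card_union_le _ _).trans (Nat.add_le_add_left ((Finset.card_union_le _ _).trans
      (Nat.add_le_add_left ((Finset.card_union_le _ _).trans (Nat.add_le_add_left
      (Finset.card_union_le _ _) _)) _)) _)) _)) _))
    exact_mod_cast this
  have c1 : (B₁.card : ℝ) ≤ X := by
    refine (card_small_mass_le_le (c := 50) (d := 11) (by norm_num) (by norm_num) (by norm_num) hm1
      (μ := 1 / 10) B₁ fun p hp => ?_).trans (Real.exp_le_exp.2 ?_)
    · have h := (Finset.mem_filter.1 hp).2
      have h' : 10 * (((p.parts.filter (fun a => 50 * a < 11 * m)).sum : ℕ) : ℝ) ≤ m * m := by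
        exact_mod_cast (not_le.1 h).le
      linarith
    · push_cast
      nlinarith
  have c2 : (B₂.card : ℝ) ≤ X := by
    refine (card_small_mass_ge_le (c := 50) (d := 11) (by norm_num) (by norm_num) hm1
      (μ := 1235 / 10000) B₂ fun p hp => ?_).trans (Real.exp_le_exp.2 ?_)
    · have h := (Finset.mem_filter.1 hp).2
      have h' : 1235 * (m * m : ℝ) ≤
          10000 * (((p.parts.filter (fun a => 50 * a < 11 * m)).sum : ℕ) : ℝ) := by
        exact_mod_cast (not_le.1 h).le
      linarith
    · push_cast
      nlinarith
  have c3 : (B₃.card : ℝ) ≤ X := by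
    refine (card_small_mass_le_le (c := 20) (d := 7) (by norm_num) (by norm_num) (by norm_num) hm1
      (μ := 15 / 100) B₃ fun p hp => ?_).trans (Real.exp_le_exp.2 ?_)
    · have h := (Finset.mem_filter.1 hp).2
      have h' : 100 * (((p.parts.filter (fun a => 20 * a < 7 * m)).sum : ℕ) : ℝ) ≤
          15 * (m * m) := by
        exact_mod_cast (not_le.1 h).le
      linarith
    · push_cast
      nlinarith
  have c4 : (B₄.card : ℝ) ≤ X := by
    refine (card_small_mass_ge_le (c := 200) (d := 101) (by norm_num) (by norm_num) hm1
      (μ := 282 / 1000) B₄ fun p hp => ?_).trans (Real.exp_le_exp.2 ?_)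
    · have h := (Finset.mem_filter.1 hp).2
      have h' : 282 * (m * m : ℝ) ≤
          1000 * (((p.parts.filter (fun a => 200 * a < 101 * m)).sum : ℕ) : ℝ) := by
        exact_mod_cast (not_le.1 h).le
      linarith
    · push_cast
      nlinarith
  have c5 : (B₅.card : ℝ) ≤ tri m * X := by
    have h1 : ∀ k ∈ Finset.Icc 1 (tri m),
        ((U.filter fun p => m * m < 1000 * k ∧ k ∈ p.parts).card : ℝ) ≤ X := by
      intro k hk
      by_cases hlt : m * m < 1000 * k
      · refine (card_large_part_le hm1 (Finset.mem_Icc.1 hk).1 (Finset.mem_Icc.1 hk).2 _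
          fun p hp => (Finset.mem_filter.1 hp).2.2).trans (Real.exp_le_exp.2 ?_)
        have h2 : (m * m : ℝ) ≤ 1000 * k := by exact_mod_cast hlt.le
        have h3 : (m : ℝ) / 1000 ≤ growth / m * k := by
          rw [div_mul_eq_mul_div, le_div_iff₀ (by linarith)]
          nlinarith
        linarith
      · rw [Finset.filter_false_of_mem fun p _ h => hlt h.1]
        simpa using (Real.exp_pos _).le
    calc (B₅.card : ℝ) ≤ ∑ k ∈ Finset.Icc 1 (tri m),
          ((U.filter fun p => m * m < 1000 * k ∧ k ∈ p.parts).card : ℝ) := by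
            exact_mod_cast Finset.card_biUnion_le
      _ ≤ ∑ k ∈ Finset.Icc 1 (tri m), X := Finset.sum_le_sum h1
      _ = tri m * X := by simp
  have missing : ∀ K, 500 * K ≤ m → m < 50000 * (K + 1) → ∀ B : Finset (tri m).Partition,
      (∀ p ∈ B, K ≤ 4 * ((Finset.Icc 1 K).filter (· ∉ p.parts)).card) → (B.card : ℝ) ≤ X := by
    intro K hK hK' B hB
    refine (card_missing_ge_le hm1 hK B hB).trans (Real.exp_le_exp.2 ?_)
    have : (m : ℝ) ≤ 50000 * (K + 1) := by exact_mod_cast hK'.le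
    linarith
  have c6 : (B₆.card : ℝ) ≤ X := missing (m / 500) (by omega) (by omega) _
    fun p hp => (not_le.1 (Finset.mem_filter.1 hp).2).le
  have c7 : (B₇.card : ℝ) ≤ X := missing (m / 50000) (by omega) (by omega) _
    fun p hp => (not_le.1 (Finset.mem_filter.1 hp).2).le
  linarith

theorem card_partition_le {s : ℝ} (hs : 0 < s) (k : ℕ) :
    (Fintype.card k.Partition : ℝ) ≤ Real.exp (s * k + Real.pi ^ 2 / 6 / s) := by
  have := card_le_exp hs (Finset.univ : Finset k.Partition) (fun _ _ => 1)
    (fun _ _ => zero_le_one) 0 (fun p _ => by simp) (fun _ => 0) fun j hj => by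
      have hj : (0 : ℝ) < j := by exact_mod_cast (Finset.mem_Icc.1 hj).1
      simpa using sum_range_pow_le (Real.exp_pos _).le
        (exp_neg_lt_one (mul_pos hs hj)) (k + 1)
  simpa using this

theorem card_partition_mono {k n : ℕ} (h : k ≤ n) :
    Fintype.card k.Partition ≤ Fintype.card n.Partition := by
  refine Fintype.card_le_of_injective
    (fun p => ⟨p.parts + Multiset.replicate (n - k) 1, fun {i} hi => ?_, ?_⟩) fun p q hpq => ?_
  · rcases Multiset.mem_add.1 hi with hi | hi
    · exact p.parts_pos hi
    · rw [Multiset.eq_of_mem_replicate hi]; exact one_pos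
  · rw [Multiset.sum_add, p.parts_sum, Multiset.sum_replicate, smul_eq_mul, mul_one]
    omega
  · exact Nat.Partition.ext (add_right_cancel (Nat.Partition.mk.inj hpq))

theorem prod_sum_pow_le {q T : ℝ} (hq : 0 ≤ q)
    (hT : ∀ L, ∑ k ∈ Finset.range L, (Fintype.card k.Partition : ℝ) * q ^ k ≤ T) (J I : ℕ) :
    ∏ j ∈ Finset.range J, ∑ x ∈ Finset.range I, (q ^ (j + 1)) ^ x ≤ T := by
  classical
  rw [← Fin.prod_univ_eq_prod_range (fun j => ∑ x ∈ Finset.range I, (q ^ (j + 1)) ^ x),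
    Finset.prod_univ_sum]
  let M : (Fin J → ℕ) → Multiset ℕ := fun f => ∑ i, Multiset.replicate (f i) (i.1 + 1)
  have hpos : ∀ f, ∀ {a}, a ∈ M f → 0 < a := by
    intro f a ha
    obtain ⟨i, -, hi⟩ := Multiset.mem_sum.1 ha
    rw [Multiset.eq_of_mem_replicate hi]
    omega
  let e : (Fin J → ℕ) → Σ k : ℕ, k.Partition := fun f => ⟨(M f).sum, ⟨M f, hpos f, rfl⟩⟩
  have hM : ∀ {x y : Σ k : ℕ, k.Partition}, x = y → x.2.parts = y.2.parts := by
    rintro x y rfl; rfl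
  have he : Function.Injective e := by
    intro f g hfg
    have h : M f = M g := hM hfg
    funext i
    have hc : ∀ f, (M f).count (i.1 + 1) = f i := by
      intro f
      simp only [M, Multiset.count_sum', Multiset.count_replicate, Nat.add_right_cancel_iff,
        Fin.val_inj]
      simp
    rw [← hc f, ← hc g, h]
  set F := Fintype.piFinset fun _ : Fin J => Finset.range I
  have hw : ∀ f, ∏ i : Fin J, (q ^ (i.1 + 1)) ^ f i = q ^ (e f).1 := by
    intro f
    simp only [e, M, Multiset.sum_sum, Multiset.sum_replicate, smul_eq_mul, ← pow_mul]
    rw [Finset.prod_pow_eq_pow_sum]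
    congr 1
    exact Finset.sum_congr rfl fun i _ => mul_comm _ _
  set L := (F.image fun f => (e f).1).sup id + 1
  calc ∑ f ∈ F, ∏ i : Fin J, (q ^ (i.1 + 1)) ^ f i
      = ∑ y ∈ F.image e, q ^ y.1 := by
        rw [Finset.sum_image he.injOn]
        exact Finset.sum_congr rfl fun f _ => hw f
    _ ≤ ∑ y ∈ (Finset.range L).sigma fun k => (Finset.univ : Finset k.Partition), q ^ y.1 := by
        refine Finset.sum_le_sum_of_subset_of_nonneg (fun y hy => ?_) fun _ _ _ => by positivity
        obtain ⟨f, hf, rfl⟩ := Finset.mem_image.1 hy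
        refine Finset.mem_sigma.2 ⟨Finset.mem_range_succ_iff.2 ?_, Finset.mem_univ _⟩
        exact Finset.le_sup (f := id) (Finset.mem_image_of_mem _ hf)
    _ = ∑ k ∈ Finset.range L, (Fintype.card k.Partition : ℝ) * q ^ k := by
        rw [Finset.sum_sigma]
        refine Finset.sum_congr rfl fun k _ => ?_
        simp
    _ ≤ T := hT L

/-- A lower bound for the Euler product of the partition generating function at `exp (-s)`. -/
theorem exp_sum_inv_sq_le {s T : ℝ} (hs : 0 < s)
    (hT : ∀ L, ∑ k ∈ Finset.range L, (Fintype.card k.Partition : ℝ) * Real.exp (-s) ^ k ≤ T)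
    (I : ℕ) :
    Real.exp ((∑ i ∈ Finset.range I, 1 / ((i : ℝ) + 1) ^ 2) / s - I) ≤ T := by
  have hT0 : 0 < T := by
    have := hT 1
    simp only [Finset.range_one, Finset.sum_singleton, pow_zero, mul_one] at this
    have h : (0 : ℝ) < Fintype.card (Nat.Partition 0) := by exact_mod_cast Fintype.card_pos
    linarith
  set q := Real.exp (-s) with hq
  have hq0 : 0 < q := Real.exp_pos _
  have hq1 : q < 1 := exp_neg_lt_one hs
  have hqj : ∀ j : ℕ, q ^ (j + 1) < 1 := fun j => pow_lt_one₀ hq0.le hq1 (by omega)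
  have h1 : ∀ J, ∏ j ∈ Finset.range J, (1 - q ^ (j + 1))⁻¹ ≤ T := fun J =>
    le_of_tendsto' (x := Filter.atTop) (tendsto_finsetProd _ fun j _ =>
      (hasSum_geometric_of_lt_one (by positivity) (hqj j)).tendsto_sum_nat)
      fun I => prod_sum_pow_le hq0.le hT J I
  have h2 : ∀ J, ∑ i ∈ Finset.range I, (∑ j ∈ Finset.range J, (q ^ (i + 1)) ^ (j + 1)) / (i + 1) ≤
      Real.log T := by
    intro J
    calc ∑ i ∈ Finset.range I, (∑ j ∈ Finset.range J, (q ^ (i + 1)) ^ (j + 1)) / ((i : ℝ) + 1)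
        = ∑ j ∈ Finset.range J, ∑ i ∈ Finset.range I, (q ^ (j + 1)) ^ (i + 1) / ((i : ℝ) + 1) := by
          rw [Finset.sum_comm]
          refine Finset.sum_congr rfl fun i _ => ?_
          rw [Finset.sum_div]
          refine Finset.sum_congr rfl fun j _ => ?_
          rw [← pow_mul, ← pow_mul, mul_comm]
      _ ≤ ∑ j ∈ Finset.range J, -Real.log (1 - q ^ (j + 1)) :=
          Finset.sum_le_sum fun j _ => sum_le_hasSum _ (fun i _ => by positivity)
            (Real.hasSum_pow_div_log_of_abs_lt_one
              (by rw [abs_of_pos (by positivity)]; exact hqj j))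
      _ = Real.log (∏ j ∈ Finset.range J, (1 - q ^ (j + 1))⁻¹) := by
          rw [Real.log_prod fun j _ => inv_ne_zero (by linarith [hqj j])]
          simp only [Real.log_inv]
      _ ≤ Real.log T := Real.log_le_log
          (Finset.prod_pos fun j _ => inv_pos.2 (by linarith [hqj j])) (h1 J)
  have h3 : ∑ i ∈ Finset.range I, (q ^ (i + 1) * (1 - q ^ (i + 1))⁻¹) / ((i : ℝ) + 1) ≤
      Real.log T := by
    refine le_of_tendsto' (x := Filter.atTop)
      (tendsto_finsetSum _ fun i _ => Filter.Tendsto.div_const ?_ _) h2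
    simp only [pow_succ' (q ^ (_ + 1))]
    exact ((hasSum_geometric_of_lt_one (by positivity) (hqj i)).mul_left _).tendsto_sum_nat
  rw [← Real.le_log_iff_exp_le hT0]
  refine le_trans ?_ h3
  have h4 : (I : ℝ) = ∑ i ∈ Finset.range I, 1 := by simp
  rw [h4, Finset.sum_div, ← Finset.sum_sub_distrib]
  refine Finset.sum_le_sum fun i _ => ?_
  have hu : 0 < s * ((i : ℝ) + 1) := by positivity
  have hi : (0 : ℝ) ≤ i := Nat.cast_nonneg i
  have hr : 1 - s * (i + 1) ≤ q ^ (i + 1) := by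
    have := Real.add_one_le_exp (-(s * ((i : ℝ) + 1)))
    have e : q ^ (i + 1) = Real.exp (-(s * ((i : ℝ) + 1))) := by
      rw [hq, ← Real.exp_nat_mul]; congr 1; push_cast; ring
    rw [e]; linarith
  have h5 : 1 / (s * (i + 1)) - 1 ≤ q ^ (i + 1) * (1 - q ^ (i + 1))⁻¹ := by
    rw [← div_eq_mul_inv, le_div_iff₀ (by linarith [hqj i]), div_sub_one hu.ne',
      div_mul_eq_mul_div, div_le_iff₀ hu]
    nlinarith
  rw [le_div_iff₀ (by positivity)]
  refine le_trans ?_ h5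
  have e : (1 / ((i : ℝ) + 1) ^ 2 / s - 1) * (i + 1) = 1 / (s * (i + 1)) - (i + 1) := by
    field_simp
  rw [e]
  linarith

theorem inv_one_sub_exp_neg_le {v : ℝ} (hv : 0 < v) :
    (1 - Real.exp (-v))⁻¹ ≤ 1 + 1 / v := by
  have h : 0 < 1 - Real.exp (-v) := by linarith [exp_neg_lt_one hv]
  have h1 : Real.exp (-v) * (v + 1) ≤ 1 := by
    calc Real.exp (-v) * (v + 1) ≤ Real.exp (-v) * Real.exp v := by
          gcongr
          exact Real.add_one_le_exp v
      _ = 1 := by rw [← Real.exp_add]; simp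
  rw [inv_le_iff_one_le_mul₀ h, one_add_div hv.ne', div_mul_eq_mul_div, le_div_iff₀ hv]
  nlinarith

theorem sum_card_mul_exp_le {s δ κ : ℝ} (hs : 0 < s) (hδ : 0 < δ) (hδ1 : δ < 1) (n L : ℕ) :
    ∑ k ∈ Finset.range L, (Fintype.card k.Partition : ℝ) * Real.exp (-s) ^ k ≤
      (n + 1) * (Real.exp (δ * s * κ * n + Real.pi ^ 2 / 6 / ((1 + δ) * s)) +
        Fintype.card n.Partition * Real.exp (-(s * κ * n))) +
      Real.exp (Real.pi ^ 2 / 6 / ((1 - δ) * s) - δ * s * n) * (1 + 1 / (δ * s)) := by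
  have hpow : ∀ k : ℕ, Real.exp (-s) ^ k = Real.exp (-(s * k)) := fun k => by
    rw [← Real.exp_nat_mul]; congr 1; ring
  calc ∑ k ∈ Finset.range L, (Fintype.card k.Partition : ℝ) * Real.exp (-s) ^ k
      ≤ ∑ k ∈ Finset.range (n + 1 + L), (Fintype.card k.Partition : ℝ) * Real.exp (-s) ^ k :=
        Finset.sum_le_sum_of_subset_of_nonneg
          (Finset.range_mono (by omega)) fun _ _ _ => by positivity
    _ = _ := Finset.sum_range_add _ _ _
    _ ≤ _ := add_le_add ?_ ?_
  · have := Finset.sum_le_card_nsmul (Finset.range (n + 1))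
      (fun k => (Fintype.card k.Partition : ℝ) * Real.exp (-s) ^ k)
      (Real.exp (δ * s * κ * n + Real.pi ^ 2 / 6 / ((1 + δ) * s)) +
        Fintype.card n.Partition * Real.exp (-(s * κ * n))) fun k hk => ?_
    · rwa [Finset.card_range, nsmul_eq_mul, Nat.cast_add_one] at this
    · rw [hpow]
      rcases le_total (k : ℝ) (κ * n) with h | h
      · refine le_add_of_le_of_nonneg ?_ (by positivity)
        calc (Fintype.card k.Partition : ℝ) * Real.exp (-(s * k))
            ≤ Real.exp ((1 + δ) * s * k + Real.pi ^ 2 / 6 / ((1 + δ) * s)) *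
                Real.exp (-(s * k)) := by
              gcongr
              exact card_partition_le (by positivity) k
          _ ≤ _ := by
              rw [← Real.exp_add]
              refine Real.exp_le_exp.2 ?_
              have : δ * s * k ≤ δ * s * (κ * n) := by gcongr
              linarith
      · refine le_add_of_nonneg_of_le (by positivity) ?_
        have hk : k ≤ n := Finset.mem_range_succ_iff.1 hk
        gcongr ?_ * Real.exp ?_
        · exact_mod_cast card_partition_mono hk
        · have : s * (κ * n) ≤ s * k := by gcongr
          linarith
  · have hq := exp_neg_lt_one (mul_pos hδ hs)
    calc ∑ i ∈ Finset.range L, (Fintype.card (n + 1 + i).Partition : ℝ) *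
          Real.exp (-s) ^ (n + 1 + i)
        ≤ ∑ i ∈ Finset.range L, Real.exp (Real.pi ^ 2 / 6 / ((1 - δ) * s) - δ * s * n) *
            Real.exp (-(δ * s)) ^ i := by
          refine Finset.sum_le_sum fun i _ => ?_
          have hs' : 0 < (1 - δ) * s := mul_pos (by linarith) hs
          rw [hpow, ← Real.exp_nat_mul, ← Real.exp_add]
          calc (Fintype.card (n + 1 + i).Partition : ℝ) * Real.exp (-(s * (n + 1 + i : ℕ)))
              ≤ Real.exp ((1 - δ) * s * (n + 1 + i : ℕ) + Real.pi ^ 2 / 6 / ((1 - δ) * s)) *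
                Real.exp (-(s * (n + 1 + i : ℕ))) := by
                gcongr
                exact card_partition_le hs' _
            _ ≤ _ := by
                rw [← Real.exp_add]
                refine Real.exp_le_exp.2 ?_
                push_cast
                have := mul_pos hδ hs
                linarith
      _ ≤ _ := by
          rw [← Finset.mul_sum]
          gcongr
          exact (sum_range_pow_le (Real.exp_pos _).le hq L).trans
            (inv_one_sub_exp_neg_le (mul_pos hδ hs))

theorem eventually_mul_exp_le {a b : ℝ} (hab : a < b) (C : ℝ) :
    ∀ᶠ m : ℕ in Filter.atTop, C * ((m : ℝ) + 1) ^ 2 * Real.exp (a * m) ≤ Real.exp (b * m) := by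
  have h := (isLittleO_pow_exp_pos_mul_atTop 2 (sub_pos.2 hab)).comp_tendsto
    (Filter.tendsto_atTop_add_const_right _ 1 (tendsto_natCast_atTop_atTop (R := ℝ)))
  have hc : 0 < Real.exp (-(b - a)) / (|C| + 1) := by positivity
  filter_upwards [h.bound hc] with m hm
  simp only [Function.comp_apply, norm_pow, Real.norm_eq_abs, Real.abs_exp, sq_abs] at hm
  calc C * ((m : ℝ) + 1) ^ 2 * Real.exp (a * m)
      ≤ (|C| + 1) * (Real.exp (-(b - a)) / (|C| + 1) * Real.exp ((b - a) * (m + 1))) *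
          Real.exp (a * m) := by
        have : C ≤ |C| + 1 := by linarith [le_abs_self C]
        gcongr
    _ = Real.exp (-(b - a)) * Real.exp ((b - a) * (m + 1)) * Real.exp (a * m) := by
        field_simp
    _ = Real.exp (b * m) := by
        rw [← Real.exp_add, ← Real.exp_add]
        congr 1
        ring

theorem exists_sum_inv_sq_ge {ε : ℝ} (hε : 0 < ε) :
    ∃ I, Real.pi ^ 2 / 6 * (1 - ε) ≤ ∑ i ∈ Finset.range I, 1 / ((i : ℝ) + 1) ^ 2 := by
  have h := hasSum_zeta_two.tendsto_sum_nat.eventually_const_le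
    (show Real.pi ^ 2 / 6 * (1 - ε) < Real.pi ^ 2 / 6 by
      have := Real.pi_pos
      have : 0 < Real.pi ^ 2 / 6 * ε := by positivity
      linarith)
  obtain ⟨I, hI⟩ := (h.and (Filter.eventually_ge_atTop 1)).exists
  obtain ⟨J, rfl⟩ := Nat.exists_eq_add_of_le' hI.2
  refine ⟨J, hI.1.trans ?_⟩
  rw [Finset.sum_range_succ']
  simp

/-- A weak form of the Hardy-Ramanujan lower bound, by comparing the generating function with its
terms near the saddle point. -/
theorem eventually_exp_le_card_partition :
    ∀ᶠ m : ℕ in Filter.atTop,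
      Real.exp ((growth - 3 / 1000000) * m) ≤ Fintype.card (tri m).Partition := by
  obtain ⟨δ, hδ⟩ : ∃ δ : ℝ, δ = 1 / 2000000 := ⟨_, rfl⟩
  obtain ⟨I, hI⟩ := exists_sum_inv_sq_ge (show (0 : ℝ) < δ ^ 3 by rw [hδ]; norm_num)
  have hg := growth_pos
  have hg1 := growth_gt
  have hg2 := growth_lt
  set g := growth
  set cM := g / 2 * ((1 - δ ^ 3) / (1 + δ)) with hcM
  set cA := g / 2 * (δ * (1 - 4 * δ) * (1 + δ) + 1 / (1 + δ) ^ 2) with hcA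
  set cD := g / 2 * (1 / ((1 + δ) * (1 - δ)) - δ * (1 + δ)) with hcD
  set cW := g / 2 * ((1 + δ) * (1 - 4 * δ)) with hcW
  have hAM : cA < cM := by
    rw [hcA, hcM]; gcongr; rw [hδ]; norm_num
  have hDM : cD < cM := by
    rw [hcD, hcM]; gcongr; rw [hδ]; norm_num
  have hMW : g - 3 / 1000000 < cM + cW := by
    rw [hcM, hcW, ← mul_add]
    have : 2 - 31 / 10 / 1000000 ≤ (1 - δ ^ 3) / (1 + δ) + (1 + δ) * (1 - 4 * δ) := by
      rw [hδ]; norm_num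
    nlinarith only [this, hg2, hg]
  filter_upwards [eventually_mul_exp_le hAM (4 * Real.exp (I + 1)),
    eventually_mul_exp_le hDM (4 * 2000001 * Real.exp I),
    eventually_mul_exp_le hMW (2 * Real.exp I), Filter.eventually_ge_atTop 1]
    with m hA hD hW hm
  have hm : (1 : ℝ) ≤ m := by exact_mod_cast hm
  have hδ0 : 0 < δ := by rw [hδ]; norm_num
  have hδ1 : δ < 1 := by rw [hδ]; norm_num
  set s := (1 + δ) * g / m with hsdef
  have hs : 0 < s := by positivity
  have key := exp_sum_inv_sq_le hs
    (sum_card_mul_exp_le (κ := 1 - 4 * δ) hs hδ0 hδ1 (tri m)) I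
  set P : ℝ := (Fintype.card (tri m).Partition : ℝ)
  have hZ : Real.pi ^ 2 / 6 = g ^ 2 / 2 := by rw [growth_sq]; ring
  rw [hZ] at key hI
  have hd : 1 - δ ≠ 0 := by linarith
  have e1 : cM * m - I ≤ (∑ i ∈ Finset.range I, 1 / ((i : ℝ) + 1) ^ 2) / s - I := by
    have : cM * m = g ^ 2 / 2 * (1 - δ ^ 3) / s := by
      rw [hcM, hsdef]; field_simp
    rw [this]; gcongr
  have e2 : δ * s * (1 - 4 * δ) * (tri m : ℕ) + g ^ 2 / 2 / ((1 + δ) * s) ≤ cA * m + 1 := by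
    have : δ * s * (1 - 4 * δ) * (tri m : ℕ) + g ^ 2 / 2 / ((1 + δ) * s) =
        cA * m + g / 2 * (δ * (1 - 4 * δ) * (1 + δ)) := by
      rw [hcA, hsdef, cast_tri]; field_simp; ring
    rw [this]
    have : g / 2 * (δ * (1 - 4 * δ) * (1 + δ)) ≤ g / 2 * 1 := by
      gcongr
      rw [hδ]; norm_num
    linarith only [this, hg2]
  have e3 : -(s * (1 - 4 * δ) * (tri m : ℕ)) ≤ -(cW * m) := by
    have : s * (1 - 4 * δ) * (tri m : ℕ) = cW * m + g / 2 * ((1 + δ) * (1 - 4 * δ)) := by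
      rw [hcW, hsdef, cast_tri]; field_simp
    rw [this]
    have : 0 ≤ g / 2 * ((1 + δ) * (1 - 4 * δ)) :=
      mul_nonneg (by positivity) (by rw [hδ]; norm_num)
    linarith only [this]
  have e4 : g ^ 2 / 2 / ((1 - δ) * s) - δ * s * (tri m : ℕ) ≤ cD * m := by
    have : g ^ 2 / 2 / ((1 - δ) * s) - δ * s * (tri m : ℕ) =
        cD * m - g / 2 * (δ * (1 + δ)) := by
      rw [hcD, hsdef, cast_tri]; field_simp; ring
    rw [this]
    have : 0 ≤ g / 2 * (δ * (1 + δ)) := by positivity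
    linarith only [this]
  have e5 : 1 + 1 / (δ * s) ≤ 2000001 * ((m : ℝ) + 1) ^ 2 := by
    have : 1 / (δ * s) ≤ 2000000 * m := by
      rw [div_le_iff₀ (by positivity), hsdef, hδ]
      field_simp
      linarith only [hg1]
    nlinarith only [this, hm]
  have e6 : ((tri m : ℕ) : ℝ) + 1 ≤ (m + 1) ^ 2 := by
    rw [cast_tri]; nlinarith only [hm]
  have k2 : Real.exp (cM * m - I) ≤
      ((m : ℝ) + 1) ^ 2 * (Real.exp (cA * m + 1) + P * Real.exp (-(cW * m))) +
        Real.exp (cD * m) * (2000001 * ((m : ℝ) + 1) ^ 2) := by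
    refine (Real.exp_le_exp.2 e1).trans (key.trans ?_)
    gcongr
  rw [Real.exp_sub, div_le_iff₀ (Real.exp_pos _), Real.exp_add, Real.exp_neg] at k2
  rw [Real.exp_add] at hA
  rw [add_mul, Real.exp_add] at hW
  have hE := Real.exp_pos (cW * m)
  have k3 : Real.exp (cM * m) ≤
      2 * (((m : ℝ) + 1) ^ 2 * (P * (Real.exp (cW * m))⁻¹) * Real.exp I) := by
    linarith only [k2, hA, hD]
  have k4 : Real.exp (cM * m) * Real.exp (cW * m) ≤
      2 * (((m : ℝ) + 1) ^ 2 * P * Real.exp I) := by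
    calc _ ≤ 2 * (((m : ℝ) + 1) ^ 2 * (P * (Real.exp (cW * m))⁻¹) * Real.exp I) *
          Real.exp (cW * m) := by gcongr
      _ = _ := by field_simp
  have k5 := hW.trans k4
  have hI0 := Real.exp_pos I
  have : 0 < 2 * Real.exp I * ((m : ℝ) + 1) ^ 2 := by positivity
  exact le_of_mul_le_mul_left (by linarith only [k5]) this

/-- Under the uniform measure on partitions of `n = T_m`, the probability that a
random partition admits a good staircase decomposition tends to `1` as `m → ∞`. -/
theorem uniform_good_decomposition :
    Filter.Tendsto
      (fun m : ℕ =>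
        (Nat.card {f : ℕ → ℕ // IsPtnFun f ∧ psize f = tri m ∧ GoodDecomp m f} : ℝ) /
          (Nat.card {f : ℕ → ℕ // IsPtnFun f ∧ psize f = tri m} : ℝ))
      Filter.atTop (nhds 1) := by
  classical
  have hone : ∀ m, (Nat.card {f : ℕ → ℕ // IsPtnFun f ∧ psize f = tri m ∧ GoodDecomp m f} : ℝ) /
      (Nat.card {f : ℕ → ℕ // IsPtnFun f ∧ psize f = tri m} : ℝ) ≤ 1 := fun m =>
    div_le_one_of_le₀ (by exact_mod_cast natCard_good_le m) (Nat.cast_nonneg _)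
  have hlim : Filter.Tendsto (fun m : ℕ => 1 - Real.exp (-(1 / 2000000) * m))
      Filter.atTop (nhds 1) := by
    have h : Filter.Tendsto (fun m : ℕ => -(1 / 2000000 : ℝ) * m) Filter.atTop Filter.atBot :=
      tendsto_natCast_atTop_atTop.const_mul_atTop_of_neg (by norm_num)
    simpa using (Real.tendsto_exp_atBot.comp h).const_sub 1
  refine tendsto_of_tendsto_of_tendsto_of_le_of_le' hlim tendsto_const_nhds ?_
    (Filter.Eventually.of_forall hone)
  filter_upwards [eventually_exp_le_card_partition,
    eventually_mul_exp_le (show (-(1 / 1000000) : ℝ) < -(1 / 2000000) by norm_num)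
      (6 * Real.exp 3), Filter.eventually_ge_atTop (10 ^ 12)] with m hlow hexp hm
  have hgood := card_goodParts_le hm
  have hbad := card_not_goodParts_le hm
  have hsum := Finset.card_filter_add_card_filter_not (s := Finset.univ)
    fun p : (tri m).Partition => GoodParts m p.parts
  rw [Finset.card_univ] at hsum
  rw [natCard_ptn]
  set P := Fintype.card (tri m).Partition
  have hP : (0 : ℝ) < P := (Real.exp_pos _).trans_le hlow
  have htri : (6 : ℝ) + tri m ≤ 6 * ((m : ℝ) + 1) ^ 2 := by
    rw [cast_tri]; nlinarith [(Nat.cast_nonneg m : (0 : ℝ) ≤ m)]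
  have hbad' : (6 + (tri m : ℝ)) * Real.exp ((growth - 1 / 250000) * m + 3) ≤
      Real.exp (-(1 / 2000000) * m) * P := by
    calc (6 + (tri m : ℝ)) * Real.exp ((growth - 1 / 250000) * m + 3)
        ≤ 6 * ((m : ℝ) + 1) ^ 2 * Real.exp ((growth - 1 / 250000) * m + 3) := by gcongr
      _ = 6 * Real.exp 3 * ((m : ℝ) + 1) ^ 2 * Real.exp (-(1 / 1000000) * m) *
            Real.exp ((growth - 3 / 1000000) * m) := by
          rw [show (growth - 1 / 250000) * (m : ℝ) + 3 = 3 + -(1 / 1000000) * m +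
            (growth - 3 / 1000000) * m by ring, Real.exp_add, Real.exp_add]
          ring
      _ ≤ _ := by gcongr
  rw [le_div_iff₀ hP]
  have h1 : (P : ℝ) = (Finset.univ.filter fun p : (tri m).Partition => GoodParts m p.parts).card +
      (Finset.univ.filter fun p : (tri m).Partition => ¬ GoodParts m p.parts).card := by
    exact_mod_cast hsum.symm
  have h2 : ((Finset.univ.filter fun p : (tri m).Partition => GoodParts m p.parts).card : ℝ) ≤
      Nat.card {f : ℕ → ℕ // IsPtnFun f ∧ psize f = tri m ∧ GoodDecomp m f} := by
    exact_mod_cast hgood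
  linarith
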